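/- Let g ≥ 6. For p ≥ 0, call a (p+1)-tuple w = (v_0,…,v_p) of vectors of H a p-simplex of Λ̂(g) if the v_i are pairwise ω-orthogonal, each v_i has a_1-coordinate equal to 1, and gcd(v_0,…,v_p) = 1. For such a tuple w, let Λ³((w,b_1)^⊥) denote the subspace of the third exterior power Λ³(ℚ^{2(g+1)}) spanned by all z_1∧z_2∧z_3 with each z_i ∈ ℚ^{2(g+1)} ω-orthogonal to b_1 and to every entry of w. For p ≥ 1, let C_p be the direct sum, over all (p−1)-simplices w of Λ̂(g), of Λ³((w,b_1)^⊥), i.e. the space of finitely supported functions ξ assigning to each (p−1)-simplex w an element ξ(w) ∈ Λ³((w,b_1)^⊥); define d : C_p → C_{p−1} on the summand indexed by w by sending z to Σ_{j=0}^{p−1} (−1)^j · z placed in the summand indexed by ∂_j w, where ∂_j w deletes the j-th entry of w. Then the sequence C_3 → C_2 → C_1 is exact at C_2: every ξ ∈ C_2 with dξ = 0 equals dη for some η ∈ C_3. -/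

import Mathlib

namespace Paper

/-- The standard symplectic form on `R^{2g}` with respect to the basis
`a_1, b_1, …, a_g, b_g` (coordinates `2i, 2i+1` for `a_{i+1}, b_{i+1}`). -/
def symp {R : Type*} [CommRing R] {g : ℕ} (x y : Fin (2 * g) → R) : R :=
  ∑ i : Fin g,
    (x ⟨2 * i.1, by omega⟩ * y ⟨2 * i.1 + 1, by omega⟩ -
      x ⟨2 * i.1 + 1, by omega⟩ * y ⟨2 * i.1, by omega⟩)

theorem symp_add_left {R : Type*} [CommRing R] {g : ℕ} (x y a : Fin (2 * g) → R) :
    symp (x + y) a = symp x a + symp y a := by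
  unfold symp
  rw [← Finset.sum_add_distrib]
  exact Finset.sum_congr rfl fun i _ => by simp only [Pi.add_apply]; ring

theorem symp_smul_left {R : Type*} [CommRing R] {g : ℕ} (c : R) (x a : Fin (2 * g) → R) :
    symp (c • x) a = c * symp x a := by
  unfold symp
  rw [Finset.mul_sum]
  exact Finset.sum_congr rfl fun i _ => by simp only [Pi.smul_apply, smul_eq_mul]; ring

theorem symp_zero_left {R : Type*} [CommRing R] {g : ℕ} (a : Fin (2 * g) → R) :
    symp (0 : Fin (2 * g) → R) a = 0 := by
  unfold symp; simp

/-- The orthogonal complement `A^⊥ = {x | ω(x,a) = 0 for all a ∈ A}`. -/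
def perp {R : Type*} [CommRing R] {g : ℕ} (A : Set (Fin (2 * g) → R)) :
    Submodule R (Fin (2 * g) → R) where
  carrier := {x | ∀ a ∈ A, symp x a = 0}
  add_mem' := by
    intro x y hx hy a ha
    rw [symp_add_left, hx a ha, hy a ha, add_zero]
  zero_mem' := by
    intro a ha
    exact symp_zero_left a
  smul_mem' := by
    intro c x hx a ha
    rw [symp_smul_left, hx a ha, mul_zero]

/-- The submodule of vectors whose first `m` coordinates vanish.
`H_k = coordZero R (2*g) (2*(k-1))`, and `H₂ = coordZero R (2*(g+1)) 2`. -/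
def coordZero (R : Type*) [CommRing R] (n m : ℕ) : Submodule R (Fin n → R) where
  carrier := {v | ∀ j : Fin n, (j : ℕ) < m → v j = 0}
  add_mem' := by
    intro x y hx hy j hj
    have h1 := hx j hj
    have h2 := hy j hj
    simp [Pi.add_apply, h1, h2]
  zero_mem' := by intro j hj; rfl
  smul_mem' := by
    intro c x hx j hj
    have h1 := hx j hj
    simp [Pi.smul_apply, h1]

/-- The standard basis vector `a_{i+1}` (`i` is 0-indexed). -/
def stdA (R : Type*) [CommRing R] (g i : ℕ) : Fin (2 * g) → R :=
  fun j => if (j : ℕ) = 2 * i then 1 else 0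

/-- The standard basis vector `b_{i+1}` (`i` is 0-indexed). -/
def stdB (R : Type*) [CommRing R] (g i : ℕ) : Fin (2 * g) → R :=
  fun j => if (j : ℕ) = 2 * i + 1 then 1 else 0

/-- Regard an integer vector as a rational vector. -/
def qcast {n : ℕ} (v : Fin n → ℤ) : Fin n → ℚ := fun j => (v j : ℚ)

/-- The projection `pr₂` deleting the `a_1`- and `b_1`-coordinates. -/
def pr2 {R : Type*} [CommRing R] {n : ℕ} (v : Fin n → R) : Fin n → R :=
  fun j => if (j : ℕ) < 2 then 0 else v j

/-- `gcd(v_1, …, v_m) = 1`: the vectors are linearly independent and their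
ℤ-span is a direct summand. -/
def IsUnimodular {n m : ℕ} (v : Fin m → Fin n → ℤ) : Prop :=
  LinearIndependent ℤ v ∧
    ∃ C : Submodule ℤ (Fin n → ℤ), IsCompl (Submodule.span ℤ (Set.range v)) C

/-- A primitive vector. -/
def Primitive {n : ℕ} (v : Fin n → ℤ) : Prop := IsUnimodular ![v]

/-- The entries of `w` are pairwise `ω`-orthogonal. -/
def PairwiseOrth {g m : ℕ} (w : Fin m → Fin (2 * g) → ℤ) : Prop :=
  ∀ i j, i ≠ j → symp (w i) (w j) = 0

/-- `Λ³ W`: the span of all wedges of three vectors from `W` inside the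
exterior algebra. -/
def wedge3 {g : ℕ} (W : Submodule ℚ (Fin (2 * g) → ℚ)) :
    Submodule ℚ (ExteriorAlgebra ℚ (Fin (2 * g) → ℚ)) :=
  Submodule.span ℚ {x | ∃ z₁ ∈ W, ∃ z₂ ∈ W, ∃ z₃ ∈ W,
    x = ExteriorAlgebra.ι ℚ z₁ * ExteriorAlgebra.ι ℚ z₂ * ExteriorAlgebra.ι ℚ z₃}

/-- `u ∧ Λ² W`. -/
def uWedge2 {g : ℕ} (u : Fin (2 * g) → ℚ) (W : Submodule ℚ (Fin (2 * g) → ℚ)) :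
    Submodule ℚ (ExteriorAlgebra ℚ (Fin (2 * g) → ℚ)) :=
  Submodule.span ℚ {x | ∃ z₁ ∈ W, ∃ z₂ ∈ W,
    x = ExteriorAlgebra.ι ℚ u * ExteriorAlgebra.ι ℚ z₁ * ExteriorAlgebra.ι ℚ z₂}

/-- `u ∧ u' ∧ W`. -/
def uuWedge1 {g : ℕ} (u u' : Fin (2 * g) → ℚ) (W : Submodule ℚ (Fin (2 * g) → ℚ)) :
    Submodule ℚ (ExteriorAlgebra ℚ (Fin (2 * g) → ℚ)) :=
  Submodule.span ℚ {x | ∃ z ∈ W,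
    x = ExteriorAlgebra.ι ℚ u * ExteriorAlgebra.ι ℚ u' * ExteriorAlgebra.ι ℚ z}

/-- The simplicial differential: on the summand indexed by `w` it sends `z` to
`Σ_j (-1)^j · z` placed in the summand indexed by `∂_j w`. -/
noncomputable def diff (g p : ℕ)
    (ξ : (Fin (p + 1) → Fin (2 * g) → ℤ) →₀ ExteriorAlgebra ℚ (Fin (2 * g) → ℚ)) :
    (Fin p → Fin (2 * g) → ℤ) →₀ ExteriorAlgebra ℚ (Fin (2 * g) → ℚ) :=
  ξ.sum fun w z =>
    ∑ j : Fin (p + 1), ((-1 : ℚ) ^ (j : ℕ)) • Finsupp.single (fun i => w (j.succAbove i)) z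

/-- The gcd of the determinants of all maximal square submatrices of the matrix
whose columns are the `v i`. -/
def vgcd {ι : Type*} [Fintype ι] {m : ℕ} (v : Fin m → ι → ℤ) : ℕ :=
  Finset.univ.gcd fun r : Fin m → ι => (Matrix.det (Matrix.of fun i j => v j (r i))).natAbs

section SymplecticAlgebra

variable {R : Type*} [CommRing R] {N : ℕ}

theorem symp_swap (x y : Fin (2 * N) → R) : symp x y = -symp y x := by
  unfold symp
  rw [← Finset.sum_neg_distrib]
  exact Finset.sum_congr rfl fun i _ => by ring

theorem symp_self (x : Fin (2 * N) → R) : symp x x = 0 := by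
  unfold symp
  exact Finset.sum_eq_zero fun i _ => by ring

theorem symp_add_right (a x y : Fin (2 * N) → R) : symp a (x + y) = symp a x + symp a y := by
  rw [symp_swap, symp_add_left, symp_swap x, symp_swap y]; ring

theorem symp_smul_right (c : R) (a x : Fin (2 * N) → R) : symp a (c • x) = c * symp a x := by
  rw [symp_swap, symp_smul_left, symp_swap x]; ring

theorem symp_neg_left (x a : Fin (2 * N) → R) : symp (-x) a = -symp x a := by
  rw [← neg_one_smul R x, symp_smul_left]; ring

theorem symp_neg_right (a x : Fin (2 * N) → R) : symp a (-x) = -symp a x := by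
  rw [← neg_one_smul R x, symp_smul_right]; ring

theorem symp_sub_left (x y a : Fin (2 * N) → R) : symp (x - y) a = symp x a - symp y a := by
  rw [sub_eq_add_neg, symp_add_left, symp_neg_left]; ring

theorem symp_sub_right (a x y : Fin (2 * N) → R) : symp a (x - y) = symp a x - symp a y := by
  rw [sub_eq_add_neg, symp_add_right, symp_neg_right]; ring

theorem symp_zero_right (a : Fin (2 * N) → R) : symp a (0 : Fin (2 * N) → R) = 0 := by
  rw [symp_swap, symp_zero_left, neg_zero]

theorem symp_sum_left {ι : Type*} (s : Finset ι) (f : ι → Fin (2 * N) → R)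
    (a : Fin (2 * N) → R) : symp (∑ i ∈ s, f i) a = ∑ i ∈ s, symp (f i) a := by
  classical
  induction s using Finset.induction_on with
  | empty => simp [symp_zero_left]
  | insert i s hi ih => rw [Finset.sum_insert hi, Finset.sum_insert hi, symp_add_left, ih]

/-- The linear functional `ω(·, y)`. -/
def sympLeft (y : Fin (2 * N) → R) : (Fin (2 * N) → R) →ₗ[R] R where
  toFun x := symp x y
  map_add' x x' := symp_add_left x x' y
  map_smul' c x := symp_smul_left c x y

theorem symp_stdB (hN : 0 < N) (x : Fin (2 * N) → R) :
    symp x (stdB R N 0) = x ⟨0, by omega⟩ := by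
  unfold symp stdB
  rw [Finset.sum_eq_single (⟨0, hN⟩ : Fin N)]
  · simp
  · rintro ⟨i, hi⟩ _ hne
    have : i ≠ 0 := fun h => hne (Fin.ext h)
    have h1 : ¬2 * i + 1 = 2 * 0 + 1 := by omega
    have h2 : ¬2 * i = 2 * 0 + 1 := by omega
    simp only [h1, h2, if_false]; ring
  · simp

theorem symp_eq_sum_single (x y : Fin (2 * N) → R) :
    symp x y = ∑ i, x i * symp (Pi.single i 1) y := by
  conv_lhs => rw [← Finset.univ_sum_single x]
  rw [symp_sum_left]
  refine Finset.sum_congr rfl fun i _ => ?_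
  rw [← symp_smul_left, ← Pi.single_smul, smul_eq_mul, mul_one]

/-- Every linear functional is of the form `ω(·, y)`. -/
theorem exists_symp_eq (φ : (Fin (2 * N) → R) →ₗ[R] R) : ∃ y, ∀ x, φ x = symp x y := by
  classical
  have hdec : ∀ x : Fin (2 * N) → R, x = ∑ i : Fin N,
      (x ⟨2 * i.1, by omega⟩ • (Pi.single ⟨2 * i.1, by omega⟩ 1 : Fin (2 * N) → R) +
        x ⟨2 * i.1 + 1, by omega⟩ • (Pi.single ⟨2 * i.1 + 1, by omega⟩ 1 : Fin (2 * N) → R)) := by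
    intro x
    ext j
    rw [Finset.sum_apply]
    rw [Finset.sum_eq_single (⟨j.1 / 2, by omega⟩ : Fin N)]
    · rcases Nat.even_or_odd' j.1 with ⟨k, hk | hk⟩
      · have e1 : (⟨2 * (j.1 / 2), by omega⟩ : Fin (2 * N)) = j := Fin.ext (by simp; omega)
        have e2 : (⟨2 * (j.1 / 2) + 1, by omega⟩ : Fin (2 * N)) ≠ j := fun h => by
          have := congrArg Fin.val h; simp at this; omega
        simp only [Pi.add_apply, Pi.smul_apply, e1, Pi.single_eq_same, Pi.single_eq_of_ne' e2]
        simp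
      · have e1 : (⟨2 * (j.1 / 2), by omega⟩ : Fin (2 * N)) ≠ j := fun h => by
          have := congrArg Fin.val h; simp at this; omega
        have e2 : (⟨2 * (j.1 / 2) + 1, by omega⟩ : Fin (2 * N)) = j := Fin.ext (by simp; omega)
        simp only [Pi.add_apply, Pi.smul_apply, e2, Pi.single_eq_same, Pi.single_eq_of_ne' e1]
        simp
    · rintro ⟨i, hi⟩ _ hne
      have hne' : i ≠ j.1 / 2 := fun h => hne (Fin.ext h)
      have e1 : (⟨2 * i, by omega⟩ : Fin (2 * N)) ≠ j := fun h => by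
        have := congrArg Fin.val h; simp at this; omega
      have e2 : (⟨2 * i + 1, by omega⟩ : Fin (2 * N)) ≠ j := fun h => by
        have := congrArg Fin.val h; simp at this; omega
      simp [Pi.single_eq_of_ne' e1, Pi.single_eq_of_ne' e2]
    · simp
  let y : Fin (2 * N) → R := fun j =>
    if h : j.1 % 2 = 1 then φ (Pi.single ⟨j.1 - 1, by omega⟩ 1)
    else -φ (Pi.single ⟨j.1 + 1, by omega⟩ 1)
  refine ⟨y, fun x => ?_⟩
  conv_lhs => rw [hdec x]
  rw [map_sum]
  unfold symp
  refine Finset.sum_congr rfl fun i _ => ?_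
  have y1 : y ⟨2 * i.1 + 1, by omega⟩ = φ (Pi.single ⟨2 * i.1, by omega⟩ 1) := by
    simp only [y]; rw [dif_pos (by omega)]; simp
  have y2 : y ⟨2 * i.1, by omega⟩ = -φ (Pi.single ⟨2 * i.1 + 1, by omega⟩ 1) := by
    simp only [y]; rw [dif_neg (by omega)]
  rw [y1, y2]
  simp

end SymplecticAlgebra

section HyperbolicPairs

variable {N : ℕ}

/-- The form restricts to a perfect pairing on `L`. -/
def IsPerfectOn (L : Submodule ℤ (Fin (2 * N) → ℤ)) : Prop :=
  ∀ φ : L →ₗ[ℤ] ℤ, ∃ y ∈ L, ∀ x : L, φ x = symp x.1 y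

theorem IsPerfectOn.exists_orth_pair {L : Submodule ℤ (Fin (2 * N) → ℤ)} (hL : IsPerfectOn L)
    {y₁ y₂ : Fin (2 * N) → ℤ} (h₁ : y₁ ∈ L) (h₂ : y₂ ∈ L) (h : symp y₁ y₂ = 1) :
    ∃ L' ≤ L, IsPerfectOn L' ∧ (∀ x ∈ L', symp x y₁ = 0 ∧ symp x y₂ = 0) ∧
      Module.finrank ℤ L ≤ Module.finrank ℤ L' + 2 := by
  have h' : symp y₂ y₁ = -1 := by rw [symp_swap, h]
  let L' : Submodule ℤ (Fin (2 * N) → ℤ) :=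
    L ⊓ (LinearMap.ker (sympLeft y₁) ⊓ LinearMap.ker (sympLeft y₂))
  have hmem : ∀ x, x ∈ L' ↔ x ∈ L ∧ symp x y₁ = 0 ∧ symp x y₂ = 0 := fun x => Iff.rfl
  let p : (Fin (2 * N) → ℤ) →ₗ[ℤ] (Fin (2 * N) → ℤ) :=
    LinearMap.id - (sympLeft y₂).smulRight y₁ + (sympLeft y₁).smulRight y₂
  have hp : ∀ x, p x = x - symp x y₂ • y₁ + symp x y₁ • y₂ := fun x => rfl
  have hpL : ∀ x ∈ L, p x ∈ L' := by
    intro x hx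
    rw [hmem, hp]
    refine ⟨L.add_mem (L.sub_mem hx (L.smul_mem _ h₁)) (L.smul_mem _ h₂), ?_, ?_⟩ <;>
    simp only [symp_add_left, symp_sub_left, symp_smul_left, symp_self, h, h'] <;> ring
  let q : L →ₗ[ℤ] L' := (p.domRestrict L).codRestrict L' fun x => hpL x x.2
  refine ⟨L', inf_le_left, ?_, fun x hx => ((hmem x).1 hx).2, ?_⟩
  · intro φ
    obtain ⟨y, hy, hyφ⟩ := hL (φ ∘ₗ q)
    refine ⟨p y, hpL y hy, fun x => ?_⟩
    obtain ⟨hxL, hx1, hx2⟩ := (hmem x.1).1 x.2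
    have hq : q ⟨x.1, hxL⟩ = x := Subtype.ext (by
      change p x.1 = x.1
      rw [hp, hx1, hx2]; simp)
    have := hyφ ⟨x.1, hxL⟩
    rw [LinearMap.comp_apply, hq] at this
    rw [this, hp, symp_add_right, symp_sub_right, symp_smul_right, symp_smul_right, hx1, hx2]
    simp
  · let r : L →ₗ[ℤ] L' × (ℤ × ℤ) :=
      q.prod (((sympLeft y₁).domRestrict L).prod ((sympLeft y₂).domRestrict L))
    have hr : Function.Injective r := by
      rw [injective_iff_map_eq_zero]
      intro x hx
      have a1 : p x.1 = 0 := congrArg (fun t => (t.1 : Fin (2 * N) → ℤ)) hx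
      have a2 : symp x.1 y₁ = 0 := congrArg (fun t => t.2.1) hx
      have a3 : symp x.1 y₂ = 0 := congrArg (fun t => t.2.2) hx
      rw [hp, a2, a3] at a1
      exact Subtype.ext (by simpa using a1)
    have := LinearMap.finrank_le_finrank_of_injective hr
    simpa [Module.finrank_prod] using this

theorem IsPerfectOn.exists_orth {L : Submodule ℤ (Fin (2 * N) → ℤ)} (hL : IsPerfectOn L)
    (y : Fin (2 * N) → ℤ) :
    ∃ L' ≤ L, IsPerfectOn L' ∧ (∀ x ∈ L', symp x y = 0) ∧
      Module.finrank ℤ L ≤ Module.finrank ℤ L' + 2 := by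
  let φ : L →ₗ[ℤ] ℤ := (sympLeft y).domRestrict L
  have hφ : ∀ x : L, φ x = symp x.1 y := fun x => rfl
  obtain ⟨d, hd⟩ := (IsPrincipalIdealRing.principal (LinearMap.range φ)).principal
  have hdvd : ∀ x : L, d ∣ φ x := fun x => by
    have : φ x ∈ Submodule.span ℤ {d} := hd ▸ LinearMap.mem_range_self φ x
    obtain ⟨c, hc⟩ := Submodule.mem_span_singleton.1 this
    exact ⟨c, by rw [← hc, smul_eq_mul, mul_comm]⟩
  by_cases hd0 : d = 0
  · refine ⟨L, le_rfl, hL, fun x hx => ?_, by omega⟩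
    have := hdvd ⟨x, hx⟩
    rw [hd0, zero_dvd_iff] at this
    exact this
  choose c hc using hdvd
  let φ₁ : L →ₗ[ℤ] ℤ :=
    { toFun := c
      map_add' := fun x x' => mul_left_cancel₀ hd0 (by rw [← hc, map_add, hc, hc, mul_add])
      map_smul' := fun a x => mul_left_cancel₀ hd0 (by
        rw [← hc, map_smul, hc, smul_eq_mul, RingHom.id_apply, smul_eq_mul]; ring) }
  obtain ⟨y₁, hy₁, hyφ⟩ := hL φ₁
  obtain ⟨x₀, hx₀⟩ : d ∈ LinearMap.range φ := hd ▸ Submodule.mem_span_singleton_self d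
  have hone : symp x₀.1 y₁ = 1 := by
    rw [← hyφ]
    exact mul_left_cancel₀ hd0 (by
      change d * c x₀ = d * 1
      rw [← hc, hx₀, mul_one])
  obtain ⟨L', hle, hperf, horth, hrank⟩ := hL.exists_orth_pair x₀.2 hy₁ hone
  refine ⟨L', hle, hperf, fun x hx => ?_, hrank⟩
  have h1 : symp x y = φ ⟨x, hle hx⟩ := rfl
  rw [h1, hc]
  have h2 : c ⟨x, hle hx⟩ = symp x y₁ := hyφ ⟨x, hle hx⟩
  rw [h2, (horth x hx).2, mul_zero]

theorem IsPerfectOn.exists_orth_finset {L : Submodule ℤ (Fin (2 * N) → ℤ)} (hL : IsPerfectOn L)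
    (Y : Finset (Fin (2 * N) → ℤ)) :
    ∃ L' ≤ L, IsPerfectOn L' ∧ (∀ x ∈ L', ∀ y ∈ Y, symp x y = 0) ∧
      Module.finrank ℤ L ≤ Module.finrank ℤ L' + 2 * Y.card := by
  classical
  induction Y using Finset.induction_on with
  | empty => exact ⟨L, le_rfl, hL, by simp, by simp⟩
  | insert y Y hy ih =>
    obtain ⟨L₁, h1, h2, h3, h4⟩ := ih
    obtain ⟨L₂, k1, k2, k3, k4⟩ := h2.exists_orth y
    refine ⟨L₂, k1.trans h1, k2, fun x hx z hz => ?_, ?_⟩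
    · rcases Finset.mem_insert.1 hz with rfl | hz
      · exact k3 x hx
      · exact h3 x (k1 hx) z hz
    · rw [Finset.card_insert_of_notMem hy]; omega

theorem isPerfectOn_top : IsPerfectOn (⊤ : Submodule ℤ (Fin (2 * N) → ℤ)) := by
  intro φ
  obtain ⟨y, hy⟩ := exists_symp_eq (φ ∘ₗ (LinearMap.id.codRestrict ⊤ fun _ => trivial))
  exact ⟨y, trivial, fun x => hy x.1⟩

theorem IsPerfectOn.exists_pair {L : Submodule ℤ (Fin (2 * N) → ℤ)} (hL : IsPerfectOn L)
    (h : 0 < Module.finrank ℤ L) : ∃ x ∈ L, ∃ y ∈ L, symp x y = 1 := by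
  let B := Module.finBasis ℤ L
  let i : Fin (Module.finrank ℤ L) := ⟨0, h⟩
  obtain ⟨y, hy, hφ⟩ := hL (B.coord i)
  exact ⟨B i, (B i).2, y, hy, by rw [← hφ]; simp⟩

/-- A hyperbolic pair orthogonal to a given hyperbolic pair and to few further vectors. -/
theorem exists_hyperbolic {b s : Fin (2 * N) → ℤ} (hs : symp s b = 1)
    (Y : Finset (Fin (2 * N) → ℤ)) (hY : Y.card + 2 ≤ N) :
    ∃ h k, symp h k = 1 ∧ (symp h b = 0 ∧ symp h s = 0 ∧ ∀ y ∈ Y, symp h y = 0) ∧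
      (symp k b = 0 ∧ symp k s = 0 ∧ ∀ y ∈ Y, symp k y = 0) := by
  obtain ⟨L₁, -, h2, h3, h4⟩ :=
    isPerfectOn_top.exists_orth_pair (y₁ := s) (y₂ := b) trivial trivial hs
  obtain ⟨L₂, k1, k2, k3, k4⟩ := h2.exists_orth_finset Y
  have : Module.finrank ℤ (⊤ : Submodule ℤ (Fin (2 * N) → ℤ)) = 2 * N := by
    rw [finrank_top]; simp
  obtain ⟨x, hx, y, hy, hxy⟩ := k2.exists_pair (by omega)
  exact ⟨x, y, hxy, ⟨(h3 x (k1 hx)).2, (h3 x (k1 hx)).1, k3 x hx⟩,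
    ⟨(h3 y (k1 hy)).2, (h3 y (k1 hy)).1, k3 y hy⟩⟩

end HyperbolicPairs

section PartialBases

variable {N : ℕ}

/-- Integral vectors of the symplectic lattice. -/
abbrev Vec (N : ℕ) : Type := Fin (2 * N) → ℤ

/-- A finite set of pairwise orthogonal vectors pairing to `1` with `b` that admits dual vectors;
it is the vertex set of a simplex. -/
structure Good (b : Vec N) (S : Finset (Vec N)) : Prop where
  height : ∀ v ∈ S, symp v b = 1
  orth : ∀ u ∈ S, ∀ v ∈ S, symp u v = 0
  dual : ∀ v ∈ S, ∃ d, symp d v = 1 ∧ ∀ u ∈ S, u ≠ v → symp d u = 0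

/-- The vertex `x` lies in the link of the simplex `S`. -/
def Ext (b : Vec N) (S : Finset (Vec N)) (x : Vec N) : Prop :=
  x ∉ S ∧ Good b (insert x S)

/-- `x, y` span an edge in the link of `S`. -/
def IsEdge (b : Vec N) (S : Finset (Vec N)) (x y : Vec N) : Prop :=
  Ext b S x ∧ Ext b (insert x S) y

/-- `x, y, z` span a triangle in the link of `S`. -/
def IsTri (b : Vec N) (S : Finset (Vec N)) (x y z : Vec N) : Prop :=
  Ext b S x ∧ IsEdge b (insert x S) y z

/-- `w, x, y, z` span a tetrahedron in the link of `S`. -/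
def IsTetra (b : Vec N) (S : Finset (Vec N)) (w x y z : Vec N) : Prop :=
  Ext b S w ∧ IsTri b (insert w S) x y z

variable {b : Vec N} {S : Finset (Vec N)} {w x y z : Vec N}

theorem Good.mono {S' : Finset (Vec N)} (h : Good b S) (hS : S' ⊆ S) : Good b S' :=
  ⟨fun v hv => h.height v (hS hv), fun u hu v hv => h.orth u (hS hu) v (hS hv), fun v hv => by
    obtain ⟨d, h1, h2⟩ := h.dual v (hS hv)
    exact ⟨d, h1, fun u hu => h2 u (hS hu)⟩⟩

theorem good_empty (b : Vec N) : Good b ∅ := ⟨by simp, by simp, by simp⟩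

theorem Good.base_notMem (h : Good b S) : b ∉ S := fun hb => by
  have := h.height b hb
  rw [symp_self] at this
  exact zero_ne_one this

theorem ext_of_dual (h : Good b S) (hx : symp x b = 1) (hS : ∀ u ∈ S, symp x u = 0) {d : Vec N}
    (hd : symp d x = 1) (hdS : ∀ u ∈ S, symp d u = 0) : Ext b S x := by
  have hxS : x ∉ S := fun hmem => by rw [hdS x hmem] at hd; exact zero_ne_one hd
  refine ⟨hxS, ⟨?_, ?_, ?_⟩⟩
  · intro v hv
    rcases Finset.mem_insert.1 hv with rfl | hv
    · exact hx
    · exact h.height v hv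
  · intro u hu v hv
    rcases Finset.mem_insert.1 hu with rfl | hu' <;> rcases Finset.mem_insert.1 hv with rfl | hv'
    · exact symp_self _
    · exact hS v hv'
    · rw [symp_swap, hS u hu', neg_zero]
    · exact h.orth u hu' v hv'
  · intro v hv
    rcases Finset.mem_insert.1 hv with rfl | hv
    · refine ⟨d, hd, fun u hu hne => ?_⟩
      exact hdS u ((Finset.mem_insert.1 hu).resolve_left hne)
    · obtain ⟨e, he, heS⟩ := h.dual v hv
      refine ⟨e - symp e x • d, ?_, fun u hu hne => ?_⟩
      · rw [symp_sub_left, symp_smul_left, he, hdS v hv]; ring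
      · rw [symp_sub_left, symp_smul_left]
        rcases Finset.mem_insert.1 hu with rfl | hu
        · rw [hd]; ring
        · rw [heS u hu hne, hdS u hu]; ring

namespace Ext

theorem good (h : Ext b S x) : Good b S := h.2.mono (Finset.subset_insert x S)

theorem height (h : Ext b S x) : symp x b = 1 := h.2.height x (Finset.mem_insert_self x S)

theorem orth (h : Ext b S x) : ∀ u ∈ S, symp x u = 0 := fun u hu =>
  h.2.orth x (Finset.mem_insert_self x S) u (Finset.mem_insert_of_mem hu)

theorem exists_dual (h : Ext b S x) : ∃ d, symp d x = 1 ∧ ∀ u ∈ S, symp d u = 0 := by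
  obtain ⟨d, h1, h2⟩ := h.2.dual x (Finset.mem_insert_self x S)
  exact ⟨d, h1, fun u hu => h2 u (Finset.mem_insert_of_mem hu) fun e => h.1 (e ▸ hu)⟩

theorem ne_base (h : Ext b S x) : x ≠ b := fun e =>
  h.2.base_notMem (e ▸ Finset.mem_insert_self x S)

theorem mono {S' : Finset (Vec N)} (h : Ext b S x) (hS : S' ⊆ S) : Ext b S' x :=
  ⟨fun hx => h.1 (hS hx), h.2.mono (Finset.insert_subset_insert x hS)⟩

theorem swap (h₁ : Ext b S x) (h₂ : Ext b (insert x S) y) : Ext b (insert y S) x := by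
  refine ⟨fun hx => ?_, ?_⟩
  · rcases Finset.mem_insert.1 hx with rfl | hx
    · exact h₂.1 (Finset.mem_insert_self _ _)
    · exact h₁.1 hx
  · rw [Finset.insert_comm]; exact h₂.2

end Ext

theorem IsEdge.right (h : IsEdge b S x y) : Ext b S y := h.2.mono (Finset.subset_insert _ _)

theorem IsEdge.symm (h : IsEdge b S x y) : IsEdge b S y x := ⟨h.right, h.1.swap h.2⟩

theorem IsEdge.ne (h : IsEdge b S x y) : x ≠ y := fun e =>
  h.2.1 (e ▸ Finset.mem_insert_self _ _)

theorem IsEdge.orth (h : IsEdge b S x y) : symp x y = 0 := by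
  rw [symp_swap, h.2.orth x (Finset.mem_insert_self _ _), neg_zero]

theorem IsEdge.mono {S' : Finset (Vec N)} (h : IsEdge b S x y) (hS : S' ⊆ S) : IsEdge b S' x y :=
  ⟨h.1.mono hS, h.2.mono (Finset.insert_subset_insert x hS)⟩

theorem IsTri.swap_right (h : IsTri b S x y z) : IsTri b S x z y := ⟨h.1, h.2.symm⟩

theorem IsTri.swap_left (h : IsTri b S x y z) : IsTri b S y x z := by
  refine ⟨IsEdge.right ⟨h.1, h.2.1⟩, h.1.swap h.2.1, ?_⟩
  rw [Finset.insert_comm]; exact h.2.2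

theorem IsTri.edge (h : IsTri b S x y z) : IsEdge b S y z := h.2.mono (Finset.subset_insert _ _)

theorem IsTri.mono {S' : Finset (Vec N)} (h : IsTri b S x y z) (hS : S' ⊆ S) :
    IsTri b S' x y z :=
  ⟨h.1.mono hS, h.2.mono (Finset.insert_subset_insert x hS)⟩

theorem IsTri.good (h : IsTri b S x y z) : Good b (insert x (insert y (insert z S))) := by
  have := h.2.2.2
  rwa [Finset.insert_comm, Finset.insert_comm z x, Finset.insert_comm y x] at this

theorem IsTetra.swap_right (h : IsTetra b S w x y z) : IsTetra b S w x z y :=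
  ⟨h.1, h.2.swap_right⟩

theorem IsTetra.swap_mid (h : IsTetra b S w x y z) : IsTetra b S w y x z :=
  ⟨h.1, h.2.swap_left⟩

theorem IsTetra.swap_left (h : IsTetra b S w x y z) : IsTetra b S x w y z := by
  refine ⟨IsEdge.right ⟨h.1, h.2.1⟩, h.1.swap h.2.1, ?_⟩
  rw [Finset.insert_comm]; exact h.2.2

theorem IsTetra.tri (h : IsTetra b S w x y z) : IsTri b S x y z :=
  h.2.mono (Finset.subset_insert _ _)

theorem IsTetra.good (h : IsTetra b S w x y z) :
    Good b (insert w (insert x (insert y (insert z S)))) := by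
  have := h.2.good
  rwa [Finset.insert_comm z w, Finset.insert_comm y w, Finset.insert_comm x w] at this

/-- Dual vectors of a simplex together with its base vector. -/
theorem Good.exists_dual_family (h : Good b S) (hb : ∃ o, symp o b = 1) :
    ∃ l : Vec N → Vec N, ∀ u ∈ insert b S, ∀ v ∈ insert b S,
      symp (l u) v = if u = v then 1 else 0 := by
  classical
  obtain ⟨s, hsb, hs⟩ : ∃ s, symp s b = 1 ∧ ∀ u ∈ S, symp s u = 0 := by
    rcases S.eq_empty_or_nonempty with rfl | ⟨s, hs⟩
    · obtain ⟨o, ho⟩ := hb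
      exact ⟨o, ho, by simp⟩
    · exact ⟨s, h.height s hs, fun u hu => h.orth s hs u hu⟩
  have hex : ∀ u, ∃ d, u ∈ insert b S → ∀ v ∈ insert b S,
      symp d v = if u = v then 1 else 0 := by
    intro u
    by_cases hu : u ∈ insert b S
    swap
    · exact ⟨0, fun h => absurd h hu⟩
    rcases Finset.mem_insert.1 hu with rfl | hu'
    · refine ⟨s, fun _ v hv => ?_⟩
      rcases Finset.mem_insert.1 hv with rfl | hv
      · simpa using hsb
      · rw [hs v hv, if_neg]
        rintro rfl
        exact h.base_notMem hv
    · obtain ⟨d, h1, h2⟩ := h.dual u hu'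
      refine ⟨d - symp d b • s, fun _ v hv => ?_⟩
      rw [symp_sub_left, symp_smul_left]
      rcases Finset.mem_insert.1 hv with rfl | hv
      · rw [hsb, if_neg]
        · ring
        · rintro rfl
          exact h.base_notMem hu'
      · rw [hs v hv]
        by_cases huv : u = v
        · subst huv; simp [h1]
        · rw [h2 v hv (Ne.symm huv), if_neg huv]; ring
  choose l hl using hex
  exact ⟨l, fun u hu v hv => hl u hu v hv⟩

end PartialBases

section AlternatingChains

variable {N : ℕ} {E : Type*} [AddCommGroup E] [Module ℚ E]

/-- Alternating `1`-chains on the link of `σ`, supported on `K`, with coefficient system `M`. -/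
structure IsCh2 (b : Vec N) (M : Finset (Vec N) → Submodule ℚ E) (σ K : Finset (Vec N))
    (ξ : Vec N → Vec N → E) : Prop where
  swap : ∀ x y, ξ x y = -ξ y x
  supp : ∀ x y, ¬IsEdge b σ x y → ξ x y = 0
  mem : ∀ x y, ξ x y ∈ M (insert x (insert y σ))
  fin : ∀ x y, x ∉ K → ξ x y = 0

/-- Alternating `2`-chains on the link of `σ`, supported on `K`, with coefficient system `M`. -/
structure IsCh3 (b : Vec N) (M : Finset (Vec N) → Submodule ℚ E) (σ K : Finset (Vec N))
    (η : Vec N → Vec N → Vec N → E) : Prop where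
  swap_left : ∀ x y z, η x y z = -η y x z
  swap_right : ∀ x y z, η x y z = -η x z y
  supp : ∀ x y z, ¬IsTri b σ x y z → η x y z = 0
  mem : ∀ x y z, η x y z ∈ M (insert x (insert y (insert z σ)))
  fin : ∀ x y z, x ∉ K → η x y z = 0

/-- Alternating `1`-cycles on the link of `σ` with coefficients in `M` are boundaries. -/
def ExactAt (b : Vec N) (M : Finset (Vec N) → Submodule ℚ E) (σ : Finset (Vec N)) : Prop :=
  ∀ K ξ, IsCh2 b M σ K ξ → (∀ y, ∑ x ∈ K, ξ x y = 0) →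
    ∃ K' η, IsCh3 b M σ K' η ∧ ∀ x y, ∑ z ∈ K', η z x y = ξ x y

variable {b : Vec N} {M : Finset (Vec N) → Submodule ℚ E} {σ K : Finset (Vec N)}

theorem IsCh3.mono {η : Vec N → Vec N → Vec N → E} (h : IsCh3 b M σ K η) {K' : Finset (Vec N)}
    (hK : K ⊆ K') : IsCh3 b M σ K' η :=
  ⟨h.swap_left, h.swap_right, h.supp, h.mem, fun x y z hx => h.fin x y z fun h' => hx (hK h')⟩

theorem IsCh3.sum_mono {η : Vec N → Vec N → Vec N → E} (h : IsCh3 b M σ K η)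
    {K' : Finset (Vec N)} (hK : K ⊆ K') (x y : Vec N) :
    ∑ z ∈ K', η z x y = ∑ z ∈ K, η z x y :=
  (Finset.sum_subset hK fun z _ hz => h.fin z x y hz).symm

theorem isCh3_zero (K : Finset (Vec N)) : IsCh3 b M σ K fun _ _ _ => 0 :=
  ⟨by simp, by simp, by simp, fun _ _ _ => Submodule.zero_mem _, by simp⟩

/-- The pairing of a vector of coefficients with the integral vector `v`. -/
def evalAt (E : Type*) [AddCommGroup E] [Module ℚ E] (v : Vec N) :
    (Fin (2 * N) → E) →ₗ[ℚ] E :=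
  ∑ i, symp (Pi.single i 1) (qcast v) • LinearMap.proj i

theorem evalAt_apply (v : Vec N) (h : Fin (2 * N) → E) :
    evalAt E v h = ∑ i, symp (Pi.single i 1) (qcast v) • h i := by
  simp [evalAt]

/-- The pure tensor of an integral vector and a coefficient. -/
def pureTensor (E : Type*) [AddCommGroup E] [Module ℚ E] (l : Vec N) :
    E →ₗ[ℚ] (Fin (2 * N) → E) :=
  LinearMap.pi fun i => (l i : ℚ) • LinearMap.id

theorem pureTensor_apply (l : Vec N) (e : E) (i : Fin (2 * N)) :
    pureTensor E l e i = (l i : ℚ) • e := rfl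

theorem symp_qcast (x y : Vec N) : symp (qcast x) (qcast y) = ((symp x y : ℤ) : ℚ) := by
  simp [symp, qcast]

theorem evalAt_pureTensor (v l : Vec N) (e : E) :
    evalAt E v (pureTensor E l e) = ((symp l v : ℤ) : ℚ) • e := by
  rw [evalAt_apply, ← symp_qcast, symp_eq_sum_single, Finset.sum_smul]
  refine Finset.sum_congr rfl fun i _ => ?_
  rw [pureTensor_apply, smul_smul, mul_comm]; rfl

/-- Tensors with first factor orthogonal to `b` and `S` and second factor in `M S`. -/
def tensorCoeff (b : Vec N) (M : Finset (Vec N) → Submodule ℚ E) (S : Finset (Vec N)) :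
    Submodule ℚ (Fin (2 * N) → E) :=
  (Submodule.pi Set.univ fun _ => M S) ⊓ ⨅ v ∈ insert b S, LinearMap.ker (evalAt E v)

theorem mem_tensorCoeff {S : Finset (Vec N)} {h : Fin (2 * N) → E} :
    h ∈ tensorCoeff b M S ↔ (∀ i, h i ∈ M S) ∧ ∀ v ∈ insert b S, evalAt E v h = 0 := by
  simp [tensorCoeff, Submodule.mem_pi]

theorem tensorCoeff_antitone (hM : Antitone M) : Antitone (tensorCoeff b M) := by
  intro S T hST h hh
  rw [mem_tensorCoeff] at hh ⊢
  exact ⟨fun i => hM hST (hh.1 i), fun v hv => hh.2 v (Finset.insert_subset_insert b hST hv)⟩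

theorem evalAt_mem {S : Finset (Vec N)} {h : Fin (2 * N) → E} (hh : ∀ i, h i ∈ M S)
    (v : Vec N) : evalAt E v h ∈ M S := by
  rw [evalAt_apply]
  exact Submodule.sum_mem _ fun i _ => Submodule.smul_mem _ _ (hh i)

/-- Componentwise filling of a cycle with tensor coefficients, corrected to have first factor
orthogonal to `b` and `σ`. -/
theorem exists_fill_components (hb : ∃ o, symp o b = 1) (hσ : Good b σ) (h₀ : ExactAt b M σ)
    {ξ : Vec N → Vec N → Fin (2 * N) → E} (hξ : IsCh2 b (tensorCoeff b M) σ K ξ)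
    (hcyc : ∀ y, ∑ x ∈ K, ξ x y = 0) :
    ∃ (K' : Finset (Vec N)) (η : Vec N → Vec N → Vec N → Fin (2 * N) → E),
      (∀ x y z, η x y z = -η y x z) ∧ (∀ x y z, η x y z = -η x z y) ∧
      (∀ x y z, ¬IsTri b σ x y z → η x y z = 0) ∧
      (∀ x y z i, η x y z i ∈ M (insert x (insert y (insert z σ)))) ∧
      (∀ x y z, x ∉ K' → η x y z = 0) ∧
      (∀ x y z, ∀ v ∈ insert b σ, evalAt E v (η x y z) = 0) ∧
      ∀ x y, ∑ z ∈ K', η z x y = ξ x y := by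
  classical
  obtain ⟨l, hl⟩ := hσ.exists_dual_family hb
  have hcomp : ∀ i, ∃ K' η, IsCh3 b M σ K' η ∧ ∀ x y, ∑ z ∈ K', η z x y = ξ x y i := by
    intro i
    refine h₀ K (fun x y => ξ x y i) ⟨?_, ?_, ?_, ?_⟩ ?_
    · intro x y; rw [hξ.swap]; rfl
    · intro x y h; rw [hξ.supp x y h]; rfl
    · intro x y; exact (mem_tensorCoeff.1 (hξ.mem x y)).1 i
    · intro x y h; rw [hξ.fin x y h]; rfl
    · intro y; simpa using congrFun (hcyc y) i
  choose K' η hη hsum using hcomp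
  let K₀ := Finset.univ.biUnion K'
  have hK : ∀ i, K' i ⊆ K₀ := fun i => Finset.subset_biUnion_of_mem K' (Finset.mem_univ i)
  let P : (Fin (2 * N) → E) →ₗ[ℚ] (Fin (2 * N) → E) :=
    LinearMap.id - ∑ u ∈ insert b σ, pureTensor E (l u) ∘ₗ evalAt E u
  have hP : ∀ h, P h = h - ∑ u ∈ insert b σ, pureTensor E (l u) (evalAt E u h) := fun h => by
    simp only [P, LinearMap.sub_apply, LinearMap.id_apply, LinearMap.sum_apply,
      LinearMap.comp_apply]
  have hPev : ∀ h, ∀ v ∈ insert b σ, evalAt E v (P h) = 0 := by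
    intro h v hv
    rw [hP, map_sub, map_sum, Finset.sum_eq_single v, evalAt_pureTensor, hl v hv v hv]
    · simp
    · intro u hu hne
      rw [evalAt_pureTensor, hl u hu v hv, if_neg hne]; simp
    · exact fun h => absurd hv h
  let η₀ : Vec N → Vec N → Vec N → Fin (2 * N) → E := fun x y z i => η i x y z
  refine ⟨K₀, fun x y z => P (η₀ x y z), ?_, ?_, ?_, ?_, ?_, ?_, ?_⟩
  · intro x y z
    change P (η₀ x y z) = -P (η₀ y x z)
    rw [← map_neg]
    exact congrArg P (funext fun i => (hη i).swap_left x y z)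
  · intro x y z
    change P (η₀ x y z) = -P (η₀ x z y)
    rw [← map_neg]
    exact congrArg P (funext fun i => (hη i).swap_right x y z)
  · intro x y z h
    change P (η₀ x y z) = 0
    rw [show η₀ x y z = 0 from funext fun i => (hη i).supp x y z h, map_zero]
  · intro x y z i
    have hm : ∀ i, η₀ x y z i ∈ M (insert x (insert y (insert z σ))) :=
      fun i => (hη i).mem x y z
    change P (η₀ x y z) i ∈ _
    rw [hP, Pi.sub_apply, Finset.sum_apply]
    refine Submodule.sub_mem _ (hm i) (Submodule.sum_mem _ fun u _ => ?_)
    rw [pureTensor_apply]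
    exact Submodule.smul_mem _ _ (evalAt_mem hm u)
  · intro x y z h
    change P (η₀ x y z) = 0
    rw [show η₀ x y z = 0 from
      funext fun i => (hη i).fin x y z fun h' => h (hK i h'), map_zero]
  · intro x y z v hv
    exact hPev _ v hv
  · intro x y
    rw [← map_sum]
    have : ∑ z ∈ K₀, η₀ z x y = ξ x y := by
      ext i
      rw [Finset.sum_apply, ← hsum i x y]
      exact (hη i).sum_mono (hK i) x y
    rw [this, hP, Finset.sum_eq_zero, sub_zero]
    intro u hu
    have hu' : u ∈ insert b (insert x (insert y σ)) := by
      rcases Finset.mem_insert.1 hu with rfl | hu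
      · exact Finset.mem_insert_self _ _
      · simp [hu]
    rw [(mem_tensorCoeff.1 (hξ.mem x y)).2 u hu', map_zero]

/-- Exactness passes to tensor coefficients, given exactness in the links of vertices. -/
theorem exactAt_tensorCoeff (hb : ∃ o, symp o b = 1) (hM : Antitone M) (hσ : Good b σ)
    (h₀ : ExactAt b M σ) (h₁ : ∀ v, Ext b σ v → ExactAt b M (insert v σ)) :
    ExactAt b (tensorCoeff b M) σ := by
  classical
  intro K ξ hξ hcyc
  obtain ⟨K₁, η, hl, hr, hsupp, hmem, hfin, hev, hsum⟩ :=
    exists_fill_components hb hσ h₀ hξ hcyc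
  -- the slices at each vertex are cycles in the link of that vertex
  have hslice : ∀ v, ∃ K' Z, IsCh3 b M (insert v σ) K' Z ∧
      (∀ x y, ∑ z ∈ K', Z z x y = evalAt E v (η v x y)) ∧
      (v ∉ K₁ → ∀ x y z, Z x y z = 0) ∧ (¬Ext b σ v → ∀ x y z, Z x y z = 0) := by
    intro v
    by_cases hv : v ∈ K₁
    swap
    · refine ⟨∅, fun _ _ _ => 0, isCh3_zero ∅, fun x y => ?_, by simp, by simp⟩
      rw [hfin v x y hv]; simp
    by_cases hvσ : Ext b σ v
    swap
    · refine ⟨∅, fun _ _ _ => 0, isCh3_zero ∅, fun x y => ?_, by simp, by simp⟩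
      rw [hsupp v x y fun h => hvσ h.1]; simp
    suffices h : IsCh2 b M (insert v σ) K₁ (fun x y => evalAt E v (η v x y)) ∧
        ∀ y, ∑ x ∈ K₁, evalAt E v (η v x y) = 0 by
      obtain ⟨K', Z, hZ, hZs⟩ := h₁ v hvσ K₁ _ h.1 h.2
      exact ⟨K', Z, hZ, hZs, fun h => absurd hv h, fun h => absurd hvσ h⟩
    refine ⟨⟨?_, ?_, ?_, ?_⟩, ?_⟩
    · intro x y; rw [hr, map_neg]
    · intro x y h; rw [hsupp v x y fun h' => h h'.2, map_zero]
    · intro x y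
      rw [Finset.insert_comm y v, Finset.insert_comm x v]
      exact evalAt_mem (hmem v x y) v
    · intro x y h; rw [hl, hfin x v y h]; simp
    · intro y
      have h1 : ∀ x, η v x y = η x y v := fun x => by rw [hl, hr, neg_neg]
      simp only [h1]
      rw [← map_sum, hsum]
      exact (mem_tensorCoeff.1 (hξ.mem y v)).2 v (by simp)
  choose K' Z hZ hZsum hZK hZext using hslice
  let K₂ := K₁ ∪ K₁.biUnion K'
  have hZ0 : ∀ v, v ∉ K₁ → ∀ x y z, Z v x y z = 0 := hZK
  have hZ2 : ∀ v, IsCh3 b M (insert v σ) K₂ (Z v) := by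
    intro v
    by_cases hv : v ∈ K₁
    · exact (hZ v).mono ((Finset.subset_biUnion_of_mem K' hv).trans Finset.subset_union_right)
    · have : Z v = fun _ _ _ => 0 := by funext x y z; exact hZ0 v hv x y z
      rw [this]; exact isCh3_zero _
  have hZsum2 : ∀ v x y, ∑ z ∈ K₂, Z v z x y = evalAt E v (η v x y) := by
    intro v x y
    by_cases hv : v ∈ K₁
    · rw [(hZ v).sum_mono ((Finset.subset_biUnion_of_mem K' hv).trans Finset.subset_union_right),
        hZsum]
    · rw [hfin v x y hv]; simp [hZ0 v hv]
  have hZtet : ∀ w x y z, ¬IsTetra b σ w x y z → Z w x y z = 0 := by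
    intro w x y z h
    by_cases hw : Ext b σ w
    · exact (hZ w).supp x y z fun h' => h ⟨hw, h'⟩
    · exact hZext w hw x y z
  have hlam : ∀ S : Finset (Vec N), ∃ l : Vec N → Vec N, Good b S →
      ∀ u ∈ insert b S, ∀ v ∈ insert b S, symp (l u) v = if u = v then 1 else 0 := by
    intro S
    by_cases hS : Good b S
    · obtain ⟨l, hl⟩ := hS.exists_dual_family hb
      exact ⟨l, fun _ => hl⟩
    · exact ⟨0, fun h => absurd h hS⟩
  choose l hlδ using hlam
  let q : Vec N → Vec N → Vec N → Vec N → Finset (Vec N) :=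
    fun w x y z => insert w (insert x (insert y (insert z σ)))
  have q1 : ∀ w x y z, q w x y z = q x w y z := fun w x y z => Finset.insert_comm _ _ _
  have q2 : ∀ w x y z, q w x y z = q w y x z := fun w x y z =>
    congrArg (insert w) (Finset.insert_comm _ _ _)
  have q3 : ∀ w x y z, q w x y z = q w x z y := fun w x y z =>
    congrArg (fun t => insert w (insert x t)) (Finset.insert_comm _ _ _)
  let ζ : Vec N → Vec N → Vec N → Vec N → Fin (2 * N) → E := fun w x y z =>
    pureTensor E (l (q w x y z) w) (Z w x y z) - pureTensor E (l (q w x y z) x) (Z x w y z) +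
      pureTensor E (l (q w x y z) y) (Z y w x z) - pureTensor E (l (q w x y z) z) (Z z w x y)
  have hζdef : ∀ w x y z, ζ w x y z =
    pureTensor E (l (q w x y z) w) (Z w x y z) - pureTensor E (l (q w x y z) x) (Z x w y z) +
      pureTensor E (l (q w x y z) y) (Z y w x z) - pureTensor E (l (q w x y z) z) (Z z w x y) :=
    fun _ _ _ _ => rfl
  have s1 : ∀ w x y z, ζ w x y z = -ζ x w y z := by
    intro w x y z
    rw [hζdef, hζdef, q1 x w, (hZ y).swap_left x w, (hZ z).swap_left x w, map_neg, map_neg]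
    abel
  have s2 : ∀ w x y z, ζ w x y z = -ζ w y x z := by
    intro w x y z
    rw [hζdef, hζdef, q2 w y, (hZ w).swap_left y x, (hZ z).swap_right w y, map_neg, map_neg]
    abel
  have s3 : ∀ w x y z, ζ w x y z = -ζ w x z y := by
    intro w x y z
    rw [hζdef, hζdef, q3 w x z, (hZ w).swap_right x z, (hZ x).swap_right w z, map_neg, map_neg]
    abel
  have htet : ∀ w x y z, ¬IsTetra b σ w x y z → Z w x y z = 0 ∧ Z x w y z = 0 ∧
      Z y w x z = 0 ∧ Z z w x y = 0 := by
    intro w x y z h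
    exact ⟨hZtet _ _ _ _ h, hZtet _ _ _ _ fun h' => h h'.swap_left,
      hZtet _ _ _ _ fun h' => h h'.swap_left.swap_mid,
      hZtet _ _ _ _ fun h' => h h'.swap_left.swap_mid.swap_right⟩
  have hζtet : ∀ w x y z, ¬IsTetra b σ w x y z → ζ w x y z = 0 := by
    intro w x y z h
    obtain ⟨e1, e2, e3, e4⟩ := htet w x y z h
    rw [hζdef, e1, e2, e3, e4]; simp
  have hevζ : ∀ w x y z, evalAt E x (ζ w x y z) = -Z x w y z := by
    intro w x y z
    by_cases h : IsTetra b σ w x y z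
    · have hg := hlδ (q w x y z) h.good
      have m1 : w ∈ insert b (q w x y z) := by simp [q]
      have m2 : x ∈ insert b (q w x y z) := by simp [q]
      have m3 : y ∈ insert b (q w x y z) := by simp [q]
      have m4 : z ∈ insert b (q w x y z) := by simp [q]
      have n1 : w ≠ x := IsEdge.ne ⟨h.1, h.2.1⟩
      have n2 : y ≠ x := (IsEdge.ne ⟨h.tri.1, h.tri.2.1⟩).symm
      have n3 : z ≠ x := (IsEdge.ne ⟨h.tri.swap_right.1, h.tri.swap_right.2.1⟩).symm
      rw [hζdef, map_sub, map_add, map_sub, evalAt_pureTensor, evalAt_pureTensor,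
        evalAt_pureTensor, evalAt_pureTensor, hg w m1 x m2, hg x m2 x m2, hg y m3 x m2,
        hg z m4 x m2, if_neg n1, if_pos rfl, if_neg n2, if_neg n3]
      simp
    · rw [hζtet w x y z h, (htet w x y z h).2.1]; simp
  have hevζσ : ∀ w x y z, ∀ v ∈ insert b σ, evalAt E v (ζ w x y z) = 0 := by
    intro w x y z v hv
    by_cases h : IsTetra b σ w x y z
    · have hg := hlδ (q w x y z) h.good
      have hvq : v ∈ insert b (q w x y z) := by
        rcases Finset.mem_insert.1 hv with rfl | hv
        · simp
        · simp [q, hv]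
      have hne : ∀ u, Ext b σ u → u ≠ v := by
        intro u hu e
        rcases Finset.mem_insert.1 hv with rfl | hv
        · exact hu.ne_base e
        · exact hu.1 (e ▸ hv)
      have e1 := h.1
      have e2 := h.tri.1
      have e3 := h.tri.edge.1
      have e4 := h.tri.edge.right
      rw [hζdef, map_sub, map_add, map_sub, evalAt_pureTensor, evalAt_pureTensor,
        evalAt_pureTensor, evalAt_pureTensor, hg w (by simp [q]) v hvq,
        hg x (by simp [q]) v hvq, hg y (by simp [q]) v hvq, hg z (by simp [q]) v hvq,
        if_neg (hne w e1), if_neg (hne x e2), if_neg (hne y e3), if_neg (hne z e4)]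
      simp
    · rw [hζtet w x y z h, map_zero]
  have hζmem : ∀ w x y z i, ζ w x y z i ∈ M (insert x (insert y (insert z σ))) := by
    intro w x y z i
    have key : ∀ u x₁ x₂ x₃, q u x₁ x₂ x₃ = q w x y z → ∀ i,
        pureTensor E (l (q w x y z) u) (Z u x₁ x₂ x₃) i ∈
          M (insert x (insert y (insert z σ))) := by
      intro u x₁ x₂ x₃ hq i
      rw [pureTensor_apply]
      refine Submodule.smul_mem _ _ (hM (Finset.subset_insert w _) ?_)
      have := (hZ u).mem x₁ x₂ x₃
      rw [Finset.insert_comm x₃ u, Finset.insert_comm x₂ u, Finset.insert_comm x₁ u] at this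
      exact (congrArg M hq) ▸ this
    rw [hζdef]
    refine Submodule.sub_mem _ (Submodule.add_mem _ (Submodule.sub_mem _ ?_ ?_) ?_) ?_
    · exact key w x y z rfl i
    · exact key x w y z (q1 _ _ _ _) i
    · exact key y w x z (by rw [q1, q2]) i
    · exact key z w x y (by rw [q1, q2, q3]) i
  let η₂ : Vec N → Vec N → Vec N → Fin (2 * N) → E :=
    fun x y z => η x y z + ∑ w ∈ K₂, ζ w x y z
  have hη₂ : ∀ x y z, η₂ x y z = η x y z + ∑ w ∈ K₂, ζ w x y z := fun _ _ _ => rfl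
  have t1 : ∀ x y z, η₂ x y z = -η₂ y x z := by
    intro x y z
    rw [hη₂, hη₂, hl x, neg_add, ← Finset.sum_neg_distrib]
    simp only [← s2]
  have t2 : ∀ x y z, η₂ x y z = -η₂ x z y := by
    intro x y z
    rw [hη₂, hη₂, hr x, neg_add, ← Finset.sum_neg_distrib]
    simp only [← s3]
  have hev₂ : ∀ x y z, evalAt E x (η₂ x y z) = 0 := by
    intro x y z
    rw [hη₂, map_add, map_sum]
    simp only [hevζ]
    rw [Finset.sum_neg_distrib, hZsum2, add_neg_cancel]
  refine ⟨K₂, η₂, ⟨t1, t2, ?_, ?_, ?_⟩, ?_⟩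
  · intro x y z h
    rw [hη₂, hsupp x y z h, Finset.sum_eq_zero, add_zero]
    exact fun w _ => hζtet w x y z fun h' => h h'.tri
  · intro x y z
    rw [mem_tensorCoeff]
    refine ⟨fun i => ?_, fun v hv => ?_⟩
    · rw [hη₂, Pi.add_apply, Finset.sum_apply]
      exact Submodule.add_mem _ (hmem x y z i) (Submodule.sum_mem _ fun w _ => hζmem w x y z i)
    · have hσv : v ∈ insert b σ → evalAt E v (η₂ x y z) = 0 := by
        intro hv
        rw [hη₂, map_add, map_sum, hev x y z v hv, Finset.sum_eq_zero, add_zero]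
        exact fun w _ => hevζσ w x y z v hv
      simp only [Finset.mem_insert] at hv
      rcases hv with rfl | rfl | rfl | rfl | hv
      · exact hσv (Finset.mem_insert_self _ _)
      · exact hev₂ _ _ _
      · rw [t1, map_neg, hev₂, neg_zero]
      · rw [t2, t1, map_neg, map_neg, hev₂, neg_zero, neg_zero]
      · exact hσv (Finset.mem_insert_of_mem hv)
  · intro x y z hx
    have hx1 : x ∉ K₁ := fun h => hx (Finset.mem_union_left _ h)
    rw [hη₂, hfin x y z hx1, Finset.sum_eq_zero, add_zero]
    intro w _
    rw [hζdef, (hZ2 w).fin x y z hx, hZ0 x hx1, (hZ y).swap_left w x, (hZ2 y).fin x w z hx,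
      (hZ z).swap_left w x, (hZ2 z).fin x w y hx]
    simp
  · intro x y
    simp only [hη₂]
    rw [Finset.sum_add_distrib, ← Finset.sum_subset (Finset.subset_union_left : K₁ ⊆ K₂)
      fun z _ hz => hfin z x y hz, hsum]
    have hself : ∑ z ∈ K₂, ∑ w ∈ K₂, ζ w z x y = -∑ z ∈ K₂, ∑ w ∈ K₂, ζ w z x y := by
      conv_lhs => rw [Finset.sum_comm]
      rw [← Finset.sum_neg_distrib]
      refine Finset.sum_congr rfl fun z _ => ?_
      rw [← Finset.sum_neg_distrib]
      exact Finset.sum_congr rfl fun w _ => s1 z w x y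
    have htf : IsAddTorsionFree (Fin (2 * N) → E) := .of_module_rat _
    rw [self_eq_neg.1 hself, add_zero]

end AlternatingChains

section Potentials

variable {N : ℕ}

/-- Every antisymmetric function on the edges of the link of `σ` that is additive on triangles is
the coboundary of a function on vertices. -/
def HasPotentials (b : Vec N) (σ : Finset (Vec N)) : Prop :=
  ∀ (Q : Type) [AddCommGroup Q] (F : Vec N → Vec N → Q), (∀ x y, F x y = -F y x) →
    (∀ x y z, IsTri b σ x y z → F x y + F y z = F x z) →
    ∃ P : Vec N → Q, ∀ x y, IsEdge b σ x y → P y - P x = F x y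

variable {b : Vec N} {σ : Finset (Vec N)}

/-- Extension of a potential to new vertices whose old neighbourhoods are connected. -/
theorem exists_extend_potential {Q : Type} [AddCommGroup Q] {F : Vec N → Vec N → Q}
    (hF : ∀ x y, F x y = -F y x) (hT : ∀ x y z, IsTri b σ x y z → F x y + F y z = F x z)
    {E₀ : Vec N → Vec N → Prop} {P : Vec N → Q} (hP : ∀ x y, E₀ x y → P y - P x = F x y)
    (S : Vec N → Vec N → Prop)
    (hS : ∀ v w w', S v w → S v w' →
      Relation.ReflTransGen (fun x y => E₀ x y ∧ IsTri b σ v x y) w w') :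
    ∃ P' : Vec N → Q, ∀ v v' w, S v w → S v' w → IsTri b σ w v v' → P' v' - P' v = F v v' := by
  classical
  let P' : Vec N → Q := fun v => if h : ∃ w, S v w then P h.choose + F h.choose v else 0
  have key : ∀ v w, S v w → P' v = P w + F w v := by
    intro v w hw
    have hex : ∃ w, S v w := ⟨w, hw⟩
    have hP' : P' v = P hex.choose + F hex.choose v := dif_pos hex
    have hind : ∀ w', Relation.ReflTransGen (fun x y => E₀ x y ∧ IsTri b σ v x y) hex.choose w' →
        P hex.choose + F hex.choose v = P w' + F w' v := by
      intro w' hpath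
      induction hpath with
      | refl => rfl
      | tail _ hstep ih =>
        rename_i x y _
        rw [ih]
        have h1 := hP _ _ hstep.1
        have h2 := hT _ _ _ hstep.2
        rw [hF x v, hF y v, ← h2, ← h1]; abel
    rw [hP', hind w (hS v _ _ hex.choose_spec hw)]
  refine ⟨P', fun v v' w hw hw' htri => ?_⟩
  rw [key v w hw, key v' w hw', ← hT _ _ _ htri]; abel

/-- Extension of a potential along a rank function, all of whose descending links are
connected. -/
theorem exists_potential_of_rank {Q : Type} [AddCommGroup Q] {F : Vec N → Vec N → Q}
    (hF : ∀ x y, F x y = -F y x) (hT : ∀ x y z, IsTri b σ x y z → F x y + F y z = F x z)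
    (A : Vec N → Prop) (rk : Vec N → ℕ) {P₀ : Vec N → Q}
    (h₀ : ∀ x y, A x → A y → rk x = 0 → rk y = 0 → IsEdge b σ x y → P₀ y - P₀ x = F x y)
    (h₁ : ∀ v w w', A v → A w → A w' → IsEdge b σ v w → IsEdge b σ v w' → rk w < rk v →
      rk w' < rk v → Relation.ReflTransGen
        (fun x y => IsTri b σ v x y ∧ (A x ∧ rk x < rk v) ∧ A y ∧ rk y < rk v) w w')
    (h₂ : ∀ v v', A v → A v' → IsEdge b σ v v' → rk v = rk v' → 0 < rk v →
      ∃ w, A w ∧ rk w < rk v ∧ IsTri b σ w v v') :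
    ∃ P : Vec N → Q, ∀ x y, A x → A y → IsEdge b σ x y → P y - P x = F x y := by
  classical
  let S : Vec N → Vec N → Prop := fun v w => A w ∧ IsEdge b σ v w ∧ rk w < rk v
  let P : Vec N → Q := (measure rk).wf.fix fun v IH =>
    if h : ∃ w, S v w then IH h.choose h.choose_spec.2.2 + F h.choose v else P₀ v
  have hPeq : ∀ v, P v = if h : ∃ w, S v w then P h.choose + F h.choose v else P₀ v := fun v =>
    (measure rk).wf.fix_eq _ v
  have hmain : ∀ n x y, rk x < n → rk y < n → A x → A y → IsEdge b σ x y →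
      P y - P x = F x y := by
    intro n
    induction n with
    | zero => intro x y hx; exact absurd hx (Nat.not_lt_zero _)
    | succ n ih =>
      have key : ∀ v w, rk v ≤ n → A v → S v w → P v = P w + F w v := by
        intro v w hv hAv hw
        have hex : ∃ w, S v w := ⟨w, hw⟩
        have hP' : P v = P hex.choose + F hex.choose v := by rw [hPeq, dif_pos hex]
        have hind : ∀ w', Relation.ReflTransGen
            (fun x y => IsTri b σ v x y ∧ (A x ∧ rk x < rk v) ∧ A y ∧ rk y < rk v)
              hex.choose w' → P hex.choose + F hex.choose v = P w' + F w' v := by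
          intro w' hpath
          induction hpath with
          | refl => rfl
          | tail _ hstep hrec =>
            rename_i x y _
            rw [hrec]
            obtain ⟨htri, ⟨hAx, hx⟩, hAy, hy⟩ := hstep
            have h1 := ih x y (by omega) (by omega) hAx hAy htri.edge
            have h2 := hT _ _ _ htri
            rw [hF x v, hF y v, ← h2, ← h1]; abel
        have hc := hex.choose_spec
        rw [hP', hind w (h₁ v _ _ hAv hc.1 hw.1 hc.2.1 hw.2.1 hc.2.2 hw.2.2)]
      intro x y hx hy hAx hAy hxy
      rcases lt_trichotomy (rk x) (rk y) with hlt | heq | hlt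
      · rw [key y x (by omega) hAy ⟨hAx, hxy.symm, hlt⟩]; abel
      · rcases Nat.eq_zero_or_pos (rk x) with h0 | hpos
        · have e : ∀ v, rk v = 0 → P v = P₀ v := by
            intro v hv
            rw [hPeq, dif_neg]
            rintro ⟨w, -, -, hw⟩
            omega
          rw [e x h0, e y (by omega)]
          exact h₀ x y hAx hAy h0 (by omega) hxy
        · obtain ⟨w, hAw, hw, htri⟩ := h₂ x y hAx hAy hxy heq hpos
          rw [key x w (by omega) hAx ⟨hAw,
              (⟨htri.swap_left.1, htri.swap_left.2.1⟩ : IsEdge b σ x w), hw⟩,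
            key y w (by omega) hAy ⟨hAw,
              (⟨htri.swap_right.swap_left.1, htri.swap_right.swap_left.2.1⟩ : IsEdge b σ y w),
              by omega⟩, ← hT _ _ _ htri]
          abel
      · rw [key x y (by omega) hAx ⟨hAy, hxy, hlt⟩, hF x y]; abel
  refine ⟨P, fun x y => hmain (max (rk x) (rk y) + 1) x y (by omega) (by omega)⟩

/-- The constant coefficient system. -/
abbrev constCoeff (N : ℕ) : Finset (Vec N) → Submodule ℚ ℚ := fun _ => ⊤

theorem IsCh3.add {b : Vec N} {E : Type*} [AddCommGroup E] [Module ℚ E]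
    {M : Finset (Vec N) → Submodule ℚ E} {σ K : Finset (Vec N)}
    {η η' : Vec N → Vec N → Vec N → E} (h : IsCh3 b M σ K η) (h' : IsCh3 b M σ K η') :
    IsCh3 b M σ K fun x y z => η x y z + η' x y z := by
  refine ⟨?_, ?_, ?_, ?_, ?_⟩
  · intro x y z; rw [h.swap_left, h'.swap_left, neg_add]
  · intro x y z; rw [h.swap_right, h'.swap_right, neg_add]
  · intro x y z hx; rw [h.supp x y z hx, h'.supp x y z hx, add_zero]
  · intro x y z; exact Submodule.add_mem _ (h.mem x y z) (h'.mem x y z)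
  · intro x y z hx; rw [h.fin x y z hx, h'.fin x y z hx, add_zero]

theorem IsCh3.smul {b : Vec N} {E : Type*} [AddCommGroup E] [Module ℚ E]
    {M : Finset (Vec N) → Submodule ℚ E} {σ K : Finset (Vec N)}
    {η : Vec N → Vec N → Vec N → E} (h : IsCh3 b M σ K η) (c : ℚ) :
    IsCh3 b M σ K fun x y z => c • η x y z := by
  refine ⟨?_, ?_, ?_, ?_, ?_⟩
  · intro x y z; rw [h.swap_left, smul_neg]
  · intro x y z; rw [h.swap_right, smul_neg]
  · intro x y z hx; rw [h.supp x y z hx, smul_zero]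
  · intro x y z; exact Submodule.smul_mem _ _ (h.mem x y z)
  · intro x y z hx; rw [h.fin x y z hx, smul_zero]

/-- Boundaries of alternating `2`-chains in the link of `σ`. -/
def boundaries (b : Vec N) (σ : Finset (Vec N)) : Submodule ℚ (Vec N → Vec N → ℚ) where
  carrier := {ξ | ∃ K η, IsCh3 b (constCoeff N) σ K η ∧ ∀ x y, ∑ z ∈ K, η z x y = ξ x y}
  zero_mem' := ⟨∅, fun _ _ _ => 0, isCh3_zero ∅, by simp⟩
  add_mem' := by
    rintro ξ ξ' ⟨K, η, h, hs⟩ ⟨K', η', h', hs'⟩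
    refine ⟨K ∪ K', _, (h.mono Finset.subset_union_left).add (h'.mono Finset.subset_union_right),
      fun x y => ?_⟩
    rw [Finset.sum_add_distrib, h.sum_mono Finset.subset_union_left,
      h'.sum_mono Finset.subset_union_right, hs, hs']
    rfl
  smul_mem' := by
    rintro c ξ ⟨K, η, h, hs⟩
    refine ⟨K, _, h.smul c, fun x y => ?_⟩
    rw [← Finset.smul_sum, hs]; rfl

/-- The indicator function of a point. -/
def chi (x u : Vec N) : ℚ := if u = x then 1 else 0

theorem chi_self (x : Vec N) : chi x x = 1 := if_pos rfl

theorem chi_of_ne {x u : Vec N} (h : u ≠ x) : chi x u = 0 := if_neg h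

theorem sum_chi {K : Finset (Vec N)} {x : Vec N} (hx : x ∈ K) : ∑ u ∈ K, chi x u = 1 := by
  rw [Finset.sum_eq_single x fun u _ h => chi_of_ne h]
  · exact chi_self x
  · exact fun h => absurd hx h

/-- The elementary alternating `1`-chain at an edge. -/
def edgeChain (x y : Vec N) : Vec N → Vec N → ℚ :=
  fun u v => chi x u * chi y v - chi x v * chi y u

theorem edgeChain_neg (x y : Vec N) : edgeChain x y = -edgeChain y x := by
  funext u v
  simp only [edgeChain, Pi.neg_apply]; ring

theorem edgeChain_tri {x y z : Vec N} (h : IsTri b σ x y z) :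
    edgeChain x y + edgeChain y z - edgeChain x z ∈ boundaries b σ := by
  classical
  refine ⟨{x, y, z}, fun u v w => chi x u * edgeChain y z v w - chi x v * edgeChain y z u w +
    chi x w * edgeChain y z u v, ⟨?_, ?_, ?_, fun _ _ _ => trivial, ?_⟩, ?_⟩
  · intro u v w; simp only [edgeChain]; ring
  · intro u v w; simp only [edgeChain]; ring
  · intro u v w hn
    have key : ∀ p q r : Vec N, IsTri b σ p q r → chi p u * chi q v * chi r w = 0 := by
      intro p q r hpqr
      by_cases h1 : u = p
      · by_cases h2 : v = q
        · by_cases h3 : w = r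
          · subst h1 h2 h3; exact absurd hpqr hn
          · rw [chi_of_ne h3, mul_zero]
        · rw [chi_of_ne h2]; ring
      · rw [chi_of_ne h1]; ring
    simp only [edgeChain]
    linear_combination key x y z h - key x z y h.swap_right - key y x z h.swap_left +
      key z x y h.swap_right.swap_left + key y z x h.swap_left.swap_right -
      key z y x h.swap_right.swap_left.swap_right
  · intro u v w hu
    simp only [Finset.mem_insert, Finset.mem_singleton, not_or] at hu
    simp only [edgeChain, chi_of_ne hu.1, chi_of_ne hu.2.1, chi_of_ne hu.2.2]; ring
  · intro u v
    have hx : ∑ t ∈ ({x, y, z} : Finset (Vec N)), chi x t = 1 := sum_chi (by simp)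
    have hy : ∑ t ∈ ({x, y, z} : Finset (Vec N)), chi y t = 1 := sum_chi (by simp)
    have hz : ∑ t ∈ ({x, y, z} : Finset (Vec N)), chi z t = 1 := sum_chi (by simp)
    have e : ∀ t, chi x t * edgeChain y z u v - chi x u * edgeChain y z t v +
        chi x v * edgeChain y z t u = chi x t * edgeChain y z u v +
          chi y t * (-chi x u * chi z v + chi x v * chi z u) +
          chi z t * (chi x u * chi y v - chi x v * chi y u) := by
      intro t; simp only [edgeChain]; ring
    simp only [e, Finset.sum_add_distrib, ← Finset.sum_mul, hx, hy, hz]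
    simp only [edgeChain, Pi.add_apply, Pi.sub_apply]; ring

theorem eq_sum_edgeChain {K : Finset (Vec N)} {ξ : Vec N → Vec N → ℚ}
    (hξ : IsCh2 b (constCoeff N) σ K ξ) :
    ξ = (1 / 2 : ℚ) • ∑ x ∈ K, ∑ y ∈ K, ξ x y • edgeChain x y := by
  have hsum : ∀ u v, ∑ x ∈ K, ∑ y ∈ K, ξ x y * (chi x u * chi y v) = ξ u v := by
    intro u v
    by_cases hu : u ∈ K
    swap
    · rw [hξ.fin u v hu]
      refine Finset.sum_eq_zero fun x hx => Finset.sum_eq_zero fun y _ => ?_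
      rw [chi_of_ne (x := x) (u := u) fun e => hu (e ▸ hx)]; ring
    by_cases hv : v ∈ K
    swap
    · rw [hξ.swap, hξ.fin v u hv, neg_zero]
      refine Finset.sum_eq_zero fun x _ => Finset.sum_eq_zero fun y hy => ?_
      rw [chi_of_ne (x := y) (u := v) fun e => hv (e ▸ hy)]; ring
    rw [Finset.sum_eq_single u, Finset.sum_eq_single v]
    · rw [chi_self, chi_self]; ring
    · intro y _ hy; rw [chi_of_ne (Ne.symm hy)]; ring
    · exact fun h => absurd hv h
    · intro x _ hx
      refine Finset.sum_eq_zero fun y _ => ?_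
      rw [chi_of_ne (Ne.symm hx)]; ring
    · exact fun h => absurd hu h
  funext u v
  simp only [Pi.smul_apply, Finset.sum_apply, smul_eq_mul]
  have e : ∀ x y, ξ x y * edgeChain x y u v =
      ξ x y * (chi x u * chi y v) - ξ x y * (chi x v * chi y u) := by
    intro x y; simp only [edgeChain]; ring
  simp only [e, Finset.sum_sub_distrib, hsum]
  rw [hξ.swap v u]; ring

theorem HasPotentials.exactAt (h : HasPotentials b σ) : ExactAt b (constCoeff N) σ := by
  intro K ξ hξ hcyc
  suffices hmem : ξ ∈ boundaries b σ from hmem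
  let π := (boundaries b σ).mkQ
  obtain ⟨P, hP⟩ := h _ (fun x y => π (edgeChain x y))
    (fun x y => by rw [edgeChain_neg, map_neg]) (fun x y z hxyz => by
      rw [← map_add, ← sub_eq_zero, ← map_sub, Submodule.mkQ_apply, Submodule.Quotient.mk_eq_zero]
      exact edgeChain_tri hxyz)
  rw [← Submodule.Quotient.mk_eq_zero, ← Submodule.mkQ_apply]
  change π ξ = 0
  rw [eq_sum_edgeChain hξ]
  simp only [map_smul, map_sum]
  have e : ∀ x y, ξ x y • π (edgeChain x y) = ξ x y • P y - ξ x y • P x := by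
    intro x y
    by_cases hxy : IsEdge b σ x y
    · rw [← hP x y hxy, smul_sub]
    · rw [hξ.supp x y hxy]; simp
  have hcyc' : ∀ x, ∑ y ∈ K, ξ x y = 0 := by
    intro x
    have h1 : ∑ y ∈ K, ξ x y = -∑ y ∈ K, ξ y x := by
      rw [← Finset.sum_neg_distrib]
      exact Finset.sum_congr rfl fun y _ => hξ.swap x y
    rw [h1, hcyc, neg_zero]
  simp only [e, Finset.sum_sub_distrib]
  rw [Finset.sum_comm]
  simp only [← Finset.sum_smul, hcyc, hcyc']
  simp

end Potentials

section EmptyLink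

variable {N : ℕ} {b : Vec N}

/-- `exists_hyperbolic` with all orthogonality relations in both orders. -/
theorem exists_hyperbolic_orth (hN : 7 ≤ N) {s : Vec N} (hs : symp s b = 1)
    (Y : Finset (Vec N)) (hY : Y.card ≤ 5) :
    ∃ h k, symp h k = 1 ∧ symp k h = -1 ∧ ∀ y ∈ insert b (insert s Y),
      symp h y = 0 ∧ symp y h = 0 ∧ symp k y = 0 ∧ symp y k = 0 := by
  obtain ⟨h, k, h1, h2, h3⟩ := exists_hyperbolic hs Y (by omega)
  refine ⟨h, k, h1, by rw [symp_swap, h1], fun y hy => ?_⟩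
  suffices hh : symp h y = 0 ∧ symp k y = 0 from
    ⟨hh.1, by rw [symp_swap, hh.1, neg_zero], hh.2, by rw [symp_swap, hh.2, neg_zero]⟩
  simp only [Finset.mem_insert] at hy
  rcases hy with rfl | rfl | hy
  · exact ⟨h2.1, h3.1⟩
  · exact ⟨h2.2.1, h3.2.1⟩
  · exact ⟨h2.2.2 y hy, h3.2.2 y hy⟩

theorem Good.ext_of_right_dual {S : Finset (Vec N)} {x k : Vec N} (h : Good b S)
    (hx : symp x b = 1) (hS : ∀ u ∈ S, symp x u = 0) (hk : symp x k = 1)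
    (hkS : ∀ u ∈ S, symp k u = 0) : Ext b S x :=
  ext_of_dual h hx hS (d := -k) (by rw [symp_neg_left, symp_swap, hk, neg_neg])
    fun u hu => by rw [symp_neg_left, hkS u hu, neg_zero]

theorem ext_empty_of_dual {x d : Vec N} (hx : symp x b = 1) (hd : symp d x = 1) : Ext b ∅ x :=
  ext_of_dual (good_empty b) hx (by simp) hd (by simp)

/-- Moving a neighbour `m` of `u` in the direction of a hyperbolic pair gives a triangle. -/
theorem isTri_add {u m h k : Vec N} (hm : IsEdge b ∅ u m) (hk : symp h k = 1)
    (hb : symp h b = 0) (hu : symp h u = 0) (hm' : symp h m = 0) (ku : symp k u = 0)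
    (km : symp k m = 0) : IsTri b ∅ u m (m + h) := by
  have mu : symp m u = 0 := hm.2.orth u (by simp)
  have mk : symp m k = 0 := by rw [symp_swap, km, neg_zero]
  refine ⟨hm.1, hm.2, hm.2.2.ext_of_right_dual (k := k) ?_ ?_ ?_ ?_⟩
  · rw [symp_add_left, hb, hm.2.height, add_zero]
  · intro v hv
    simp only [Finset.mem_insert, Finset.notMem_empty, or_false] at hv
    rcases hv with rfl | rfl
    · rw [symp_add_left, symp_self, hm', add_zero]
    · rw [symp_add_left, mu, hu, add_zero]
  · rw [symp_add_left, mk, hk, zero_add]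
  · intro v hv
    simp only [Finset.mem_insert, Finset.notMem_empty, or_false] at hv
    rcases hv with rfl | rfl
    · exact km
    · exact ku

/-- Two neighbours of `u` become adjacent after moving them along two orthogonal hyperbolic
pairs. -/
theorem isTri_add_add {u m m' h k h' k' : Vec N} (hm : IsEdge b ∅ u m) (hm' : IsEdge b ∅ u m')
    (hk : symp h k = 1) (hk' : symp h' k' = 1)
    (Hh : ∀ y ∈ ({b, u, m, m'} : Finset (Vec N)), symp y h = 0 ∧ symp y k = 0)
    (Hh' : ∀ y ∈ ({b, u, m, m', h, k} : Finset (Vec N)), symp y h' = 0 ∧ symp y k' = 0) :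
    IsTri b ∅ u (m + h) (m' + (symp m' m • k + h')) := by
  have mu : symp m u = 0 := hm.2.orth u (by simp)
  have mu' : symp m' u = 0 := hm'.2.orth u (by simp)
  have mb : symp m b = 1 := hm.2.height
  have mb' : symp m' b = 1 := hm'.2.height
  have kh : symp k h = -1 := by rw [symp_swap, hk]
  simp only [Finset.mem_insert, Finset.mem_singleton, forall_eq_or_imp, forall_eq] at Hh Hh'
  obtain ⟨⟨a1, a2⟩, ⟨a3, a4⟩, ⟨a5, a6⟩, a7, a8⟩ := Hh
  obtain ⟨⟨c1, c2⟩, ⟨c3, c4⟩, ⟨c5, c6⟩, ⟨c7, c8⟩, ⟨c9, c10⟩, c11, c12⟩ := Hh'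
  have r : ∀ {x y : Vec N}, symp x y = 0 → symp y x = 0 := fun h => by
    rw [symp_swap, h, neg_zero]
  have e1 : Ext b (insert u ∅) (m + h) := by
    refine hm.1.2.ext_of_right_dual (k := k) ?_ ?_ ?_ ?_
    · simp [symp_add_left, r a1, mb]
    · simp [symp_add_left, r a3, mu]
    · simp [symp_add_left, a6, hk]
    · simp [r a4]
  refine ⟨hm.1, e1, e1.2.ext_of_right_dual (k := k') ?_ ?_ ?_ ?_⟩
  · simp [-zsmul_eq_mul, symp_add_left, symp_smul_left, mb', r a2, r c1]
  · simp [-zsmul_eq_mul, symp_add_left, symp_add_right, symp_smul_left, mu', r a4, r c3, r c5, r c9,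
      r a6, kh, a7]
  · simp [-zsmul_eq_mul, symp_add_left, symp_smul_left, c8, c12, hk']
  · simp [symp_add_right, r c4, r c6, r c10]

theorem isTri_add_back {u m h k k' h' : Vec N} {e : ℤ} (hm : IsEdge b ∅ u m)
    (hk' : symp h' k' = 1)
    (Hh : ∀ y ∈ ({b, u, m} : Finset (Vec N)), symp y k = 0)
    (Hh' : ∀ y ∈ ({b, u, m, h, k} : Finset (Vec N)), symp y h' = 0 ∧ symp y k' = 0) :
    IsTri b ∅ u (m + (e • k + h')) m := by
  have r : ∀ {x y : Vec N}, symp x y = 0 → symp y x = 0 := fun h => by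
    rw [symp_swap, h, neg_zero]
  simp only [Finset.mem_insert, Finset.mem_singleton, forall_eq_or_imp, forall_eq] at Hh Hh'
  obtain ⟨a2, a4, a6⟩ := Hh
  obtain ⟨⟨c1, c2⟩, ⟨c3, c4⟩, ⟨c5, c6⟩, -, c11, c12⟩ := Hh'
  refine (isTri_add (h := e • k + h') (k := k') hm ?_ ?_ ?_ ?_ (r c4) (r c6)).swap_right
  · simp [-zsmul_eq_mul, symp_add_left, symp_smul_left, c12, hk']
  · simp [-zsmul_eq_mul, symp_add_left, symp_smul_left, r a2, r c1]
  · simp [-zsmul_eq_mul, symp_add_left, symp_smul_left, r a4, r c3]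
  · simp [-zsmul_eq_mul, symp_add_left, symp_smul_left, r a6, r c5]

theorem hasPotentials_empty (hN : 7 ≤ N) {o : Vec N} (ho : symp o b = 1) :
    HasPotentials b ∅ := by
  intro Q _ F hF hT
  have r : ∀ {x y : Vec N}, symp x y = 0 → symp y x = 0 := fun h => by
    rw [symp_swap, h, neg_zero]
  have bo : symp (-b) o = 1 := by rw [symp_neg_left, symp_swap, ho, neg_neg]
  have hoE : Ext b ∅ o := ext_empty_of_dual ho bo
  -- neighbours of both `o` and `v`
  obtain ⟨P₁, hP₁⟩ := exists_extend_potential (P := fun m => F o m) (E₀ := IsTri b ∅ o) hF hT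
    (fun x y h => by rw [← hT _ _ _ h]; abel) (fun v m => IsEdge b ∅ o m ∧ IsEdge b ∅ v m) (by
      rintro v m m' ⟨ho1, hv1⟩ ⟨ho2, hv2⟩
      obtain ⟨h, k, hk, kh, H⟩ := exists_hyperbolic_orth hN ho {v, m, m'}
        (Finset.card_le_three.trans (by norm_num))
      obtain ⟨h', k', hk', kh', H'⟩ := exists_hyperbolic_orth hN ho {v, m, m', h, k}
        Finset.card_le_five
      simp only [Finset.mem_insert, Finset.mem_singleton, forall_eq_or_imp, forall_eq] at H H'
      have step : ∀ u, symp u h = 0 → symp u k = 0 → symp u h' = 0 → symp u k' = 0 →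
          IsEdge b ∅ u m → IsEdge b ∅ u m' →
          IsTri b ∅ u m (m + h) ∧ IsTri b ∅ u (m + h) (m' + (symp m' m • k + h')) ∧
            IsTri b ∅ u (m' + (symp m' m • k + h')) m' := by
        intro u u1 u2 u3 u4 e1 e2
        refine ⟨isTri_add e1 hk ?_ (r u1) ?_ (r u2) ?_, isTri_add_add e1 e2 hk hk' ?_ ?_,
          isTri_add_back (h := h) e2 hk' ?_ ?_⟩ <;> simp [*]
      obtain ⟨s1, s2, s3⟩ := step o (by simp [H]) (by simp [H]) (by simp [H']) (by simp [H'])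
        ho1 ho2
      obtain ⟨t1, t2, t3⟩ := step v (by simp [H]) (by simp [H]) (by simp [H']) (by simp [H'])
        hv1 hv2
      exact ((Relation.ReflTransGen.single ⟨s1, t1⟩).tail ⟨s2, t2⟩).tail ⟨s3, t3⟩)
  have good : ∀ v v' m₀, IsEdge b ∅ v v' → symp m₀ b = 1 → symp m₀ o = 0 → symp m₀ v = 0 →
      symp m₀ v' = 0 → P₁ v' - P₁ v = F v v' := by
    intro v v' m₀ hvv hb ho' hv hv'
    obtain ⟨h, k, hk, kh, H⟩ := exists_hyperbolic_orth hN ho {v, v', m₀}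
      (Finset.card_le_three.trans (by norm_num))
    simp only [Finset.mem_insert, Finset.mem_singleton, forall_eq_or_imp, forall_eq] at H
    have key : ∀ S : Finset (Vec N), Good b S → (∀ u ∈ S, u = o ∨ u = v ∨ u = v') →
        Ext b S (m₀ + h) := by
      intro S hS hu
      refine hS.ext_of_right_dual (k := k) (by simp [symp_add_left, H, hb]) ?_
        (by simp [symp_add_left, H, hk]) ?_
      · intro u hu'
        rcases hu u hu' with rfl | rfl | rfl <;> simp [symp_add_left, *]
      · intro u hu'
        rcases hu u hu' with rfl | rfl | rfl <;> simp [*]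
    have hoo : IsEdge b ∅ o (m₀ + h) := ⟨hoE, key _ hoE.2 (by simp)⟩
    refine hP₁ v v' (m₀ + h) ⟨hoo, hvv.1, key _ hvv.1.2 (by simp)⟩
      ⟨hoo, hvv.right, key _ hvv.right.2 (by simp)⟩ ?_
    have : IsTri b ∅ v v' (m₀ + h) := ⟨hvv.1, hvv.2, key _ hvv.2.2 (by simp)⟩
    exact this.swap_right.swap_left
  obtain ⟨P₂, hP₂⟩ := exists_extend_potential (P := P₁)
    (E₀ := fun x y => IsEdge b ∅ x y ∧ ∃ m₀, symp m₀ b = 1 ∧ symp m₀ o = 0 ∧ symp m₀ x = 0 ∧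
      symp m₀ y = 0) hF hT
    (fun x y ⟨hxy, m₀, h1, h2, h3, h4⟩ => good x y m₀ hxy h1 h2 h3 h4)
    (fun v w => IsEdge b ∅ v w ∧ ∃ m₀, symp m₀ b = 1 ∧ symp m₀ o = 0 ∧ symp m₀ w = 0) (by
      rintro v w w' ⟨hw, m, mb, mo, mw⟩ ⟨hw', m', mb', mo', mw'⟩
      obtain ⟨h, k, hk, kh, H⟩ := exists_hyperbolic_orth hN ho {v, w, w'}
        (Finset.card_le_three.trans (by norm_num))
      obtain ⟨h', k', hk', kh', H'⟩ := exists_hyperbolic_orth hN ho {v, w, w', h, k}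
        Finset.card_le_five
      simp only [Finset.mem_insert, Finset.mem_singleton, forall_eq_or_imp, forall_eq] at H H'
      have t1 : IsTri b ∅ v w (w + h) := by
        refine isTri_add hw hk ?_ ?_ ?_ ?_ ?_ <;> simp [*]
      have t2 : IsTri b ∅ v (w + h) (w' + (symp w' w • k + h')) := by
        refine isTri_add_add hw hw' hk hk' ?_ ?_ <;> simp [*]
      have t3 : IsTri b ∅ v (w' + (symp w' w • k + h')) w' := by
        refine isTri_add_back (h := h) hw' hk' ?_ ?_ <;> simp [*]
      have ww := r (IsTri.edge t1).orth
      refine ((Relation.ReflTransGen.single ⟨⟨t1.edge, m + symp m h • k, ?_⟩, t1⟩).tail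
        ⟨⟨t2.edge, o + (symp o w • k + symp o w' • k'), ?_⟩, t2⟩).tail
        ⟨⟨t3.edge, m' + symp m' (symp w' w • k + h') • k', ?_⟩, t3⟩ <;>
      simp [-zsmul_eq_mul, symp_add_left, symp_add_right, symp_smul_left, symp_smul_right, symp_self, *])
  refine ⟨P₂, fun v v' hvv => ?_⟩
  obtain ⟨h, k, hk, kh, H⟩ := exists_hyperbolic_orth hN ho {v, v'}
    (Finset.card_le_two.trans (by norm_num))
  simp only [Finset.mem_insert, Finset.mem_singleton, forall_eq_or_imp, forall_eq] at H
  have hvv0 := hvv.orth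
  have hvb := hvv.1.height
  have key : ∀ S : Finset (Vec N), Good b S → (∀ u ∈ S, u = v ∨ u = v') → Ext b S (v + h) := by
    intro S hS hu
    refine hS.ext_of_right_dual (k := k) (by simp [symp_add_left, H, hvb]) ?_
      (by simp [symp_add_left, H, hk]) ?_
    · intro u hu'
      rcases hu u hu' with rfl | rfl <;> simp [symp_add_left, symp_self, *]
    · intro u hu'
      rcases hu u hu' with rfl | rfl <;> simp [*]
  have hm : ∃ m₀, symp m₀ b = 1 ∧ symp m₀ o = 0 ∧ symp m₀ (v + h) = 0 := by
    refine ⟨o + symp o v • k, ?_⟩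
    simp [-zsmul_eq_mul, symp_add_left, symp_add_right, symp_smul_left, symp_self, *]
  refine hP₂ v v' (v + h) ⟨⟨hvv.1, key _ hvv.1.2 (by simp)⟩, hm⟩
    ⟨⟨hvv.right, key _ hvv.right.2 (by simp)⟩, hm⟩ ?_
  have : IsTri b ∅ v v' (v + h) := ⟨hvv.1, hvv.2, key _ hvv.2.2 (by simp)⟩
  exact this.swap_right.swap_left

end EmptyLink

section Links

variable {N : ℕ} {b : Vec N}

theorem symp_sum_right {R : Type*} [CommRing R] {ι : Type*} (s : Finset ι)
    (f : ι → Fin (2 * N) → R) (a : Fin (2 * N) → R) :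
    symp a (∑ i ∈ s, f i) = ∑ i ∈ s, symp a (f i) := by
  rw [symp_swap, symp_sum_left, ← Finset.sum_neg_distrib]
  exact Finset.sum_congr rfl fun i _ => (symp_swap _ _).symm

theorem Ext.retract {T : Finset (Vec N)} {x s v : Vec N} (h : Ext b T x) (hs : s ∈ T)
    (hv : v ∈ T) (k : ℤ) : Ext b T (x - k • (v - s)) := by
  obtain ⟨d, h1, h2⟩ := h.exists_dual
  refine ext_of_dual (d := d) h.good ?_ (fun u hu => ?_) ?_ h2
  · rw [symp_sub_left, symp_smul_left, symp_sub_left, h.height, h.good.height v hv,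
      h.good.height s hs]
    ring
  · rw [symp_sub_left, symp_smul_left, symp_sub_left, h.orth u hu, h.good.orth v hv u hu,
      h.good.orth s hs u hu]
    ring
  · rw [symp_sub_right, symp_smul_right, symp_sub_right, h1, h2 v hv, h2 s hs]
    ring

theorem IsEdge.retract {T : Finset (Vec N)} {x y s v : Vec N} (h : IsEdge b T x y) (hs : s ∈ T)
    (hv : v ∈ T) (k l : ℤ) : IsEdge b T (x - k • (v - s)) (y - l • (v - s)) := by
  have h1 : IsEdge b T x (y - l • (v - s)) :=
    ⟨h.1, h.2.retract (Finset.mem_insert_of_mem hs) (Finset.mem_insert_of_mem hv) l⟩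
  exact IsEdge.symm ⟨h1.right, h1.symm.2.retract (Finset.mem_insert_of_mem hs)
    (Finset.mem_insert_of_mem hv) k⟩

theorem exists_primitive {p : Vec N} (hp : p ≠ 0) :
    ∃ (d : ℤ) (κ e : Vec N), d ≠ 0 ∧ p = d • κ ∧ symp e κ = 1 := by
  obtain ⟨d, hd⟩ := (IsPrincipalIdealRing.principal (LinearMap.range (sympLeft p))).principal
  have hdvd : ∀ i, d ∣ p i := by
    intro i
    obtain ⟨y, hy⟩ := exists_symp_eq (LinearMap.proj (R := ℤ) (φ := fun _ : Fin (2 * N) => ℤ) i)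
    have h1 : sympLeft p y ∈ LinearMap.range (sympLeft p) := ⟨y, rfl⟩
    rw [hd] at h1
    have h2 : d ∣ symp y p := Ideal.mem_span_singleton.1 h1
    have h3 : p i = symp p y := hy p
    rw [h3, symp_swap]
    exact (dvd_neg).2 h2
  have hd0 : d ≠ 0 := by
    rintro rfl
    exact hp (funext fun i => zero_dvd_iff.1 (hdvd i))
  choose κ hκ using hdvd
  have hpκ : p = d • κ := funext fun i => by rw [hκ i]; rfl
  have h1 : d ∈ LinearMap.range (sympLeft p) := by rw [hd]; exact Submodule.mem_span_singleton_self d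
  obtain ⟨e, he⟩ := h1
  refine ⟨d, κ, e, hd0, hpκ, mul_left_cancel₀ hd0 ?_⟩
  rw [← symp_smul_right, ← hpκ, mul_one]
  exact he

/-- A vertex of the link of `T` orthogonal to `p`, together with a vector `z` such that
orthogonality to `T` and `z` implies orthogonality to both. -/
theorem exists_center (hN : 7 ≤ N) {T : Finset (Vec N)} (hT : Good b T) (hc : T.card ≤ 4)
    {s p : Vec N} (hs : s ∈ T) (hp : ∀ u ∈ T, symp p u = 0) :
    ∃ κ z, Ext b T κ ∧ symp κ p = 0 ∧
      ∀ t, (∀ u ∈ T, symp t u = 0) → symp t z = 0 → symp t κ = 0 ∧ symp t p = 0 := by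
  have hsb := hT.height s hs
  obtain ⟨l, hl⟩ := hT.exists_dual_family ⟨s, hsb⟩
  have hl' : ∀ u ∈ T, ∀ v ∈ T, symp (l u) v = if u = v then 1 else 0 := fun u hu v hv =>
    hl u (Finset.mem_insert_of_mem hu) v (Finset.mem_insert_of_mem hv)
  obtain ⟨r, hr⟩ : ∃ r : Vec N, r = ∑ u ∈ T, symp (l u) p • u := ⟨_, rfl⟩
  have hrt : ∀ t, (∀ u ∈ T, symp t u = 0) → symp t r = 0 := by
    intro t ht
    rw [hr, symp_sum_right]
    exact Finset.sum_eq_zero fun u hu => by rw [symp_smul_right, ht u hu, mul_zero]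
  have hlr : ∀ u ∈ T, symp (l u) r = symp (l u) p := by
    intro u hu
    rw [hr, symp_sum_right, Finset.sum_eq_single u]
    · rw [symp_smul_right, hl' u hu u hu, if_pos rfl, mul_one]
    · intro v hv hne
      rw [symp_smul_right, hl' u hu v hv, if_neg hne.symm, mul_zero]
    · exact fun h => absurd hu h
  by_cases hpr : p = r
  · obtain ⟨h, k, hk, kh, H⟩ := exists_hyperbolic_orth hN hsb T (by omega)
    have HT : ∀ u ∈ T, _ := fun u hu =>
      H u (Finset.mem_insert_of_mem (Finset.mem_insert_of_mem hu))
    have hκ : Ext b T (s + h) := hT.ext_of_right_dual (k := k)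
      (by rw [symp_add_left, hsb, (H b (by simp)).1, add_zero])
      (fun u hu => by rw [symp_add_left, hT.orth s hs u hu, (HT u hu).1, add_zero])
      (by rw [symp_add_left, hk, (HT s hs).2.2.2, zero_add])
      fun u hu => (HT u hu).2.2.1
    refine ⟨s + h, s + h, hκ, by rw [hpr]; exact hrt _ hκ.orth, fun t ht hz => ⟨hz, ?_⟩⟩
    rw [hpr]; exact hrt t ht
  · obtain ⟨d, κ, e, hd0, hpκ, he⟩ := exists_primitive (sub_ne_zero.2 hpr)
    have hκt : ∀ t, (∀ u ∈ T, symp t u = 0) → symp t p = 0 → symp t κ = 0 := by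
      intro t ht hz
      refine (mul_eq_zero.1 ?_).resolve_left hd0
      rw [← symp_smul_right, ← hpκ, symp_sub_right, hz, hrt t ht, sub_zero]
    have hpT : ∀ u ∈ T, symp u p = 0 := fun u hu => by rw [symp_swap, hp u hu, neg_zero]
    have hκT : ∀ u ∈ T, symp κ u = 0 := fun u hu => by
      rw [symp_swap, hκt u (hT.orth u hu) (hpT u hu), neg_zero]
    have hlκ : ∀ u ∈ T, symp (l u) κ = 0 := by
      intro u hu
      refine (mul_eq_zero.1 ?_).resolve_left hd0
      rw [← symp_smul_right, ← hpκ, symp_sub_right, hlr u hu, sub_self]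
    have hκp : symp κ p = 0 := by
      rw [symp_swap, hκt p hp (symp_self p), neg_zero]
    have e1 : ∀ v, symp (e - ∑ u ∈ T, symp e u • l u) v =
        symp e v - ∑ u ∈ T, symp e u * symp (l u) v := fun v => by
      rw [symp_sub_left, symp_sum_left]
      simp only [symp_smul_left]
    have e2 : ∀ v ∈ T, symp (e - ∑ u ∈ T, symp e u • l u) v = 0 := by
      intro v hv
      rw [e1, Finset.sum_eq_single v, hl' v hv v hv, if_pos rfl, mul_one, sub_self]
      · intro u hu hne
        rw [hl' u hu v hv, if_neg hne, mul_zero]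
      · exact fun h => absurd hv h
    refine ⟨κ + (1 - symp κ b) • s, p, ext_of_dual hT ?_ ?_ (d := e - ∑ u ∈ T, symp e u • l u) ?_ e2,
      ?_, fun t ht hz => ⟨?_, hz⟩⟩
    · rw [symp_add_left, symp_smul_left, hsb]; ring
    · intro u hu
      rw [symp_add_left, symp_smul_left, hκT u hu, hT.orth s hs u hu, mul_zero, add_zero]
    · rw [symp_add_right, symp_smul_right, e2 s hs, e1, he, Finset.sum_eq_zero]
      · ring
      · intro u hu
        rw [hlκ u hu, mul_zero]
    · rw [symp_add_left, symp_smul_left, hκp, hpT s hs]; ring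
    · rw [symp_add_right, symp_smul_right, hκt t ht hz, ht s hs]; ring

/-- Any vertex of the link of `T` orthogonal to `p` has distance at most two from the centre. -/
theorem exists_edges_to_center (hN : 7 ≤ N) {T : Finset (Vec N)} (hT : Good b T)
    (hc : T.card ≤ 4) {s p : Vec N} (hs : s ∈ T) (hp : ∀ u ∈ T, symp p u = 0) :
    ∃ κ, symp κ p = 0 ∧ ∀ x, Ext b T x → symp x p = 0 →
      ∃ y, symp y p = 0 ∧ IsEdge b T x y ∧ IsEdge b T y κ := by
  obtain ⟨κ, z, hκ, hκp, hz⟩ := exists_center hN hT hc hs hp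
  refine ⟨κ, hκp, fun x hx hxp => ?_⟩
  have hsb := hT.height s hs
  obtain ⟨h, k, hk, kh, H⟩ := exists_hyperbolic_orth hN hsb (insert x (insert z (T.erase s))) (by
    have h1 := Finset.card_insert_le x (insert z (T.erase s))
    have h2 := Finset.card_insert_le z (T.erase s)
    have h3 := Finset.card_erase_of_mem hs
    omega)
  have HT : ∀ u ∈ T, symp h u = 0 ∧ symp u h = 0 ∧ symp k u = 0 ∧ symp u k = 0 := by
    intro u hu
    apply H
    by_cases hus : u = s <;> simp [hus, hu]
  have Hx := H x (by simp)
  have Hz := H z (by simp)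
  have Hh := hz h (fun u hu => (HT u hu).1) Hz.1
  have Hk := hz k (fun u hu => (HT u hu).2.2.1) Hz.2.2.1
  have key : ∀ y, Ext b T y → symp h y = 0 → symp k y = 0 → Ext b (insert y T) (s + h) := by
    intro y hy hhy hky
    refine hy.2.ext_of_right_dual (k := k) ?_ (fun u hu => ?_) ?_ fun u hu => ?_
    · rw [symp_add_left, hsb, (H b (by simp)).1, add_zero]
    · rcases Finset.mem_insert.1 hu with rfl | hu
      · rw [symp_add_left, hhy, symp_swap, hy.orth s hs, neg_zero, add_zero]
      · rw [symp_add_left, hT.orth s hs u hu, (HT u hu).1, add_zero]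
    · rw [symp_add_left, hk, (HT s hs).2.2.2, zero_add]
    · rcases Finset.mem_insert.1 hu with rfl | hu
      · exact hky
      · exact (HT u hu).2.2.1
  refine ⟨s + h, ?_, ⟨hx, key x hx Hx.1 Hx.2.2.1⟩, IsEdge.symm ⟨hκ, key κ hκ Hh.1 Hk.1⟩⟩
  rw [symp_add_left, Hh.2, symp_swap, hp s hs, neg_zero, add_zero]

theorem natAbs_emod_lt (a : ℤ) {c : ℤ} (hc : c ≠ 0) : (a - a / c * c).natAbs < c.natAbs := by
  have h1 : a - a / c * c = a % c := by rw [Int.emod_def]; ring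
  have h2 := Int.emod_nonneg a hc
  have h3 := Int.emod_lt_abs a hc
  rw [h1]
  rw [Int.abs_eq_natAbs] at h3
  omega

/-- Extension of a potential from the vertices orthogonal to `p` and `q` to the vertices
orthogonal to `p`. -/
theorem exists_potential_orth (hN : 7 ≤ N) {σ : Finset (Vec N)} (hc : σ.card ≤ 3)
    {s p q : Vec N} (hs : s ∈ σ) (hp : ∀ u ∈ σ, symp p u = 0) (hq : symp s q = 0)
    {Q : Type} [AddCommGroup Q] {F : Vec N → Vec N → Q} (hF : ∀ x y, F x y = -F y x)
    (hT : ∀ x y z, IsTri b σ x y z → F x y + F y z = F x z) {P₀ : Vec N → Q}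
    (h₀ : ∀ x y, symp x p = 0 → symp y p = 0 → symp x q = 0 → symp y q = 0 → IsEdge b σ x y →
      P₀ y - P₀ x = F x y) :
    ∃ P : Vec N → Q, ∀ x y, symp x p = 0 → symp y p = 0 → IsEdge b σ x y → P y - P x = F x y := by
  have hsp : symp s p = 0 := by rw [symp_swap, hp s hs, neg_zero]
  have hret : ∀ (x v : Vec N) (k : ℤ), symp x p = 0 → symp v p = 0 →
      symp (x - k • (v - s)) p = 0 := by
    intro x v k hx hv
    rw [symp_sub_left, symp_smul_left, symp_sub_left, hx, hv, hsp]; ring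
  have hrq : ∀ (x v : Vec N) (k : ℤ), symp (x - k • (v - s)) q = symp x q - k * symp v q := by
    intro x v k
    rw [symp_sub_left, symp_smul_left, symp_sub_left, hq, sub_zero]
  refine exists_potential_of_rank hF hT (fun w => symp w p = 0) (fun w => (symp w q).natAbs)
    (P₀ := P₀) (fun x y hx hy h1 h2 h => h₀ x y hx hy (Int.natAbs_eq_zero.1 h1)
      (Int.natAbs_eq_zero.1 h2) h) ?_ ?_
  · intro v w w' hv hw hw' hvw hvw' hr hr'
    have hv0 : symp v q ≠ 0 := fun h => by simp [h] at hr
    have hcard := Finset.card_insert_le v σ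
    obtain ⟨κ, hκp, hκ⟩ := exists_edges_to_center (s := s) (p := p) hN hvw.1.2 (by omega)
      (Finset.mem_insert_of_mem hs) (by
        intro u hu
        rcases Finset.mem_insert.1 hu with rfl | hu
        · rw [symp_swap, hv, neg_zero]
        · exact hp u hu)
    obtain ⟨y, hy, e1, e2⟩ := hκ w hvw.2 hw
    obtain ⟨y', hy', e1', e2'⟩ := hκ w' hvw'.2 hw'
    let R : Vec N → Vec N → Prop := fun x y => IsTri b σ v x y ∧
      (symp x p = 0 ∧ (symp x q).natAbs < (symp v q).natAbs) ∧
        symp y p = 0 ∧ (symp y q).natAbs < (symp v q).natAbs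
    let r : Vec N → Vec N := fun x =>
      x - (if (symp x q).natAbs < (symp v q).natAbs then 0 else symp x q / symp v q) • (v - s)
    have hrr : ∀ x, (symp (r x) q).natAbs < (symp v q).natAbs := by
      intro x
      simp only [r, hrq]
      split_ifs with h
      · simpa using h
      · exact natAbs_emod_lt _ hv0
    have hrw : ∀ x, (symp x q).natAbs < (symp v q).natAbs → r x = x := by
      intro x h
      simp only [r, if_pos h, zero_smul, sub_zero]
    have hre : ∀ x y, symp x p = 0 → symp y p = 0 → IsEdge b (insert v σ) x y →
        R (r x) (r y) := by
      intro x y hx hy h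
      exact ⟨⟨hvw.1, h.retract (Finset.mem_insert_of_mem hs) (Finset.mem_insert_self _ _) _ _⟩,
        ⟨hret _ _ _ hx hv, hrr x⟩, hret _ _ _ hy hv, hrr y⟩
    have path := (((Relation.ReflTransGen.single (r := R) (hre _ _ hw hy e1)).tail
      (hre _ _ hy hκp e2)).tail (hre _ _ hκp hy' e2'.symm)).tail (hre _ _ hy' hw' e1'.symm)
    rwa [hrw w hr, hrw w' hr'] at path
  · intro v v' hv hv' hvv _ hpos
    have hv0 : symp v q ≠ 0 := fun h => by simp [h] at hpos
    have hsb := hvv.1.good.height s hs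
    obtain ⟨h, k, hk, kh, H⟩ := exists_hyperbolic_orth hN hsb
      (insert v (insert v' (insert p (σ.erase s)))) (by
        have h1 := Finset.card_insert_le v (insert v' (insert p (σ.erase s)))
        have h2 := Finset.card_insert_le v' (insert p (σ.erase s))
        have h3 := Finset.card_insert_le p (σ.erase s)
        have h4 := Finset.card_erase_of_mem hs
        omega)
    have HT : ∀ u ∈ insert v' (insert v σ),
        symp h u = 0 ∧ symp u h = 0 ∧ symp k u = 0 ∧ symp u k = 0 := by
      intro u hu
      apply H
      simp only [Finset.mem_insert, Finset.mem_erase] at hu ⊢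
      tauto
    have hsT : s ∈ insert v' (insert v σ) :=
      Finset.mem_insert_of_mem (Finset.mem_insert_of_mem hs)
    have e0 : Ext b (insert v' (insert v σ)) (s + h) := by
      refine hvv.2.2.ext_of_right_dual (k := k) ?_ (fun u hu => ?_) ?_ fun u hu => (HT u hu).2.2.1
      · rw [symp_add_left, hsb, (H b (by simp)).1, add_zero]
      · rw [symp_add_left, hvv.2.2.orth s hsT u hu, (HT u hu).1, add_zero]
      · rw [symp_add_left, hk, (HT s hsT).2.2.2, zero_add]
    have hsh : symp (s + h) p = 0 := by
      rw [symp_add_left, hsp, (H p (by simp)).1, add_zero]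
    refine ⟨(s + h) - (symp (s + h) q / symp v q) • (v - s), hret _ _ _ hsh hv, ?_, ?_⟩
    · simp only [hrq]
      exact natAbs_emod_lt _ hv0
    · have : IsTri b σ v v' ((s + h) - (symp (s + h) q / symp v q) • (v - s)) :=
        ⟨hvv.1, hvv.2, e0.retract hsT (by simp) _⟩
      exact this.swap_right.swap_left

theorem Good.hasPotentials (hN : 7 ≤ N) {σ : Finset (Vec N)} (hσ : Good b σ) (hc : σ.card ≤ 3)
    (hne : σ.Nonempty) : HasPotentials b σ := by
  intro Q _ F hF hT
  obtain ⟨s, hs⟩ := hne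
  have hsb := hσ.height s hs
  obtain ⟨p, q, hpq, hqp, H⟩ := exists_hyperbolic_orth hN hsb σ (by omega)
  have Hσ : ∀ u ∈ σ, _ := fun u hu =>
    H u (Finset.mem_insert_of_mem (Finset.mem_insert_of_mem hu))
  obtain ⟨P₁, hP₁⟩ := exists_potential_orth (p := p) (q := q) hN hc hs
    (fun u hu => (Hσ u hu).1) (Hσ s hs).2.2.2 hF hT (P₀ := F (s + p)) (by
      intro x y hxp hyp hxq hyq hxy
      have e : Ext b (insert y (insert x σ)) (s + p) := by
        refine hxy.2.2.ext_of_right_dual (k := q) ?_ (fun u hu => ?_) ?_ fun u hu => ?_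
        · rw [symp_add_left, hsb, (H b (by simp)).1, add_zero]
        · rw [symp_add_left, hxy.2.2.orth s
            (Finset.mem_insert_of_mem (Finset.mem_insert_of_mem hs)) u hu, zero_add, symp_swap]
          rcases Finset.mem_insert.1 hu with rfl | hu
          · rw [hyp, neg_zero]
          rcases Finset.mem_insert.1 hu with rfl | hu
          · rw [hxp, neg_zero]
          · rw [(Hσ u hu).2.1, neg_zero]
        · rw [symp_add_left, hpq, (Hσ s hs).2.2.2, zero_add]
        · rw [symp_swap]
          rcases Finset.mem_insert.1 hu with rfl | hu
          · rw [hyq, neg_zero]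
          rcases Finset.mem_insert.1 hu with rfl | hu
          · rw [hxq, neg_zero]
          · rw [(Hσ u hu).2.2.2, neg_zero]
      have t : IsTri b σ x y (s + p) := ⟨hxy.1, hxy.2, e⟩
      rw [← hT _ _ _ t.swap_right.swap_left]
      abel)
  obtain ⟨P₂, hP₂⟩ := exists_potential_orth (p := 0) (q := p) hN hc hs
    (fun u _ => symp_zero_left u) (Hσ s hs).2.1 hF hT (P₀ := P₁)
    (fun x y _ _ hx hy hxy => hP₁ x y hx hy hxy)
  exact ⟨P₂, fun x y hxy => hP₂ x y (symp_zero_right x) (symp_zero_right y) hxy⟩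

end Links

section ConstantCoefficients

variable {N : ℕ} {b : Vec N}

theorem exactAt_constCoeff (hN : 7 ≤ N) (hb : ∃ o, symp o b = 1) {σ : Finset (Vec N)}
    (hσ : Good b σ) (hc : σ.card ≤ 3) : ExactAt b (constCoeff N) σ := by
  rcases σ.eq_empty_or_nonempty with rfl | hne
  · obtain ⟨o, ho⟩ := hb
    exact (hasPotentials_empty hN ho).exactAt
  · exact (hσ.hasPotentials hN hc hne).exactAt

theorem exactAt_tensorCoeff_of_card {E : Type*} [AddCommGroup E] [Module ℚ E]
    {M : Finset (Vec N) → Submodule ℚ E} (hb : ∃ o, symp o b = 1) (hM : Antitone M) {n : ℕ}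
    (h : ∀ σ, Good b σ → σ.card ≤ n + 1 → ExactAt b M σ) (σ : Finset (Vec N)) (hσ : Good b σ)
    (hc : σ.card ≤ n) : ExactAt b (tensorCoeff b M) σ :=
  exactAt_tensorCoeff hb hM hσ (h σ hσ (by omega)) fun v hv => h _ hv.2
    ((Finset.card_insert_le v σ).trans (by omega))

/-- Threefold tensors orthogonal to `b` and `S` in every factor. -/
abbrev tensorCube (b : Vec N) :
    Finset (Vec N) → Submodule ℚ (Fin (2 * N) → Fin (2 * N) → Fin (2 * N) → ℚ) :=
  tensorCoeff b (tensorCoeff b (tensorCoeff b (constCoeff N)))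

theorem exactAt_tensorCube (hN : 7 ≤ N) (hb : ∃ o, symp o b = 1) :
    ExactAt b (tensorCube b) ∅ := by
  have h0 : Antitone (constCoeff N) := fun _ _ _ => le_rfl
  have h1 := tensorCoeff_antitone (b := b) h0
  exact exactAt_tensorCoeff_of_card (n := 0) hb (tensorCoeff_antitone h1)
    (exactAt_tensorCoeff_of_card hb h1
      (exactAt_tensorCoeff_of_card hb h0 fun _ hσ hc => exactAt_constCoeff hN hb hσ hc))
    ∅ (good_empty b) le_rfl

end ConstantCoefficients

section Unimodular

variable {N : ℕ} {b : Vec N}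

theorem isUnimodular_iff {m : ℕ} {w : Fin m → Vec N} :
    IsUnimodular w ↔ ∃ d : Fin m → Vec N, ∀ i j, symp (d i) (w j) = if i = j then 1 else 0 := by
  constructor
  · rintro ⟨hli, C, hC⟩
    have hex : ∀ i, ∃ d : Vec N, ∀ j, symp d (w j) = if i = j then 1 else 0 := by
      intro i
      obtain ⟨y, hy⟩ := exists_symp_eq
        ((Module.Basis.span hli).coord i ∘ₗ Submodule.projectionOnto _ C hC)
      refine ⟨-y, fun j => ?_⟩
      have h1 : Submodule.projectionOnto _ C hC (w j) = Module.Basis.span hli j := by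
        have := Submodule.projectionOnto_apply_left hC (Module.Basis.span hli j)
        have h0 : ((Module.Basis.span hli j : Submodule.span ℤ (Set.range w)) : Vec N) = w j := by
          rw [Module.Basis.span_apply]
        rwa [h0] at this
      rw [symp_neg_left, ← symp_swap, ← hy, LinearMap.comp_apply, h1, Module.Basis.coord_apply,
        Module.Basis.repr_self, Finsupp.single_apply]
      simp only [eq_comm]
    choose d hd using hex
    exact ⟨d, hd⟩
  · rintro ⟨d, hd⟩
    have key : ∀ (c : Fin m → ℤ) i, symp (d i) (∑ j, c j • w j) = c i := by
      intro c i
      rw [symp_sum_right]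
      simp only [symp_smul_right, hd]
      simp
    refine ⟨Fintype.linearIndependent_iff.2 fun c hc i => ?_,
      ⨅ i, LinearMap.ker (sympLeft (d i)), ?_, ?_⟩
    · rw [← key c i, hc, symp_zero_right]
    · rw [Submodule.disjoint_def]
      intro x hx hxC
      obtain ⟨c, rfl⟩ := (Submodule.mem_span_range_iff_exists_fun ℤ).1 hx
      simp only [Submodule.mem_iInf, LinearMap.mem_ker] at hxC
      refine Finset.sum_eq_zero fun i _ => ?_
      have h1 : symp (∑ j, c j • w j) (d i) = 0 := hxC i
      rw [symp_swap, key, neg_eq_zero] at h1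
      rw [h1, zero_smul]
    · rw [codisjoint_iff, eq_top_iff]
      intro x _
      rw [Submodule.mem_sup]
      refine ⟨∑ i, symp (d i) x • w i, (Submodule.mem_span_range_iff_exists_fun ℤ).2 ⟨_, rfl⟩,
        x - ∑ i, symp (d i) x • w i, ?_, add_sub_cancel _ _⟩
      simp only [Submodule.mem_iInf, LinearMap.mem_ker]
      intro i
      change symp _ _ = 0
      rw [symp_swap, symp_sub_right, key, sub_self, neg_zero]

theorem isSimplex_iff {m : ℕ} {w : Fin m → Vec N} :
    (PairwiseOrth w ∧ (∀ i, symp (w i) b = 1) ∧ IsUnimodular w) ↔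
      Function.Injective w ∧ Good b (Finset.univ.image w) := by
  rw [isUnimodular_iff]
  constructor
  · rintro ⟨h1, h2, d, hd⟩
    refine ⟨fun i j hij => ?_, ⟨by simpa using h2, ?_, ?_⟩⟩
    · by_contra hne
      have := hd i j
      rw [← hij, hd, if_pos rfl, if_neg hne] at this
      exact one_ne_zero this
    · simp only [Finset.mem_image, Finset.mem_univ, true_and, forall_exists_index,
        forall_apply_eq_imp_iff]
      intro i j
      by_cases hij : i = j
      · rw [hij, symp_self]
      · exact h1 i j hij
    · simp only [Finset.mem_image, Finset.mem_univ, true_and, forall_exists_index,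
        forall_apply_eq_imp_iff]
      intro i
      refine ⟨d i, by rw [hd, if_pos rfl], fun j hj => ?_⟩
      rw [hd, if_neg fun h => hj (by rw [h])]
  · rintro ⟨hinj, hG⟩
    have hmem : ∀ i, w i ∈ Finset.univ.image w := fun i =>
      Finset.mem_image_of_mem w (Finset.mem_univ i)
    refine ⟨fun i j _ => hG.orth _ (hmem i) _ (hmem j), fun i => hG.height _ (hmem i), ?_⟩
    choose d h1 h2 using fun i => hG.dual _ (hmem i)
    refine ⟨d, fun i j => ?_⟩
    split_ifs with h
    · rw [← h, h1]
    · exact h2 i _ (hmem j) fun h' => h (hinj h').symm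

theorem isSimplex_two_iff {w : Fin 2 → Vec N} :
    (PairwiseOrth w ∧ (∀ i, symp (w i) b = 1) ∧ IsUnimodular w) ↔ IsEdge b ∅ (w 0) (w 1) := by
  have h1 : Finset.univ.image w = insert (w 1) (insert (w 0) ∅) := by
    ext v; simp [Fin.exists_fin_two, eq_comm, or_comm]
  rw [isSimplex_iff, h1]
  constructor
  · rintro ⟨hinj, hG⟩
    refine ⟨⟨by simp, hG.mono (by simp)⟩, ?_, hG⟩
    simpa using hinj.ne (show (1 : Fin 2) ≠ 0 by decide)
  · rintro ⟨-, h2, hG⟩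
    refine ⟨fun i j hij => ?_, hG⟩
    simp only [insert_empty_eq, Finset.mem_singleton] at h2
    fin_cases i <;> fin_cases j <;> simp_all [eq_comm]

theorem isSimplex_three_iff {w : Fin 3 → Vec N} :
    (PairwiseOrth w ∧ (∀ i, symp (w i) b = 1) ∧ IsUnimodular w) ↔
      IsTri b ∅ (w 0) (w 1) (w 2) := by
  have h1 : Finset.univ.image w = insert (w 2) (insert (w 1) (insert (w 0) ∅)) := by
    ext v; simp [Fin.exists_fin_succ, eq_comm]; tauto
  rw [isSimplex_iff, h1]
  constructor
  · rintro ⟨hinj, hG⟩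
    refine ⟨⟨by simp, hG.mono (by simp)⟩, ⟨?_, hG.mono (by simp)⟩, ?_, hG⟩
    · simpa using hinj.ne (show (1 : Fin 3) ≠ 0 by decide)
    · simpa using ⟨hinj.ne (show (2 : Fin 3) ≠ 1 by decide), hinj.ne (show (2 : Fin 3) ≠ 0 by decide)⟩
  · rintro ⟨-, ⟨h2, -⟩, h3, hG⟩
    refine ⟨fun i j hij => ?_, hG⟩
    simp only [insert_empty_eq, Finset.mem_singleton, Finset.mem_insert, not_or] at h2 h3
    fin_cases i <;> fin_cases j <;> simp_all [eq_comm]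

end Unimodular

section WedgeCoefficients

variable {N : ℕ} {b : Vec N}

/-- The rational exterior algebra. -/
abbrev Wedge (N : ℕ) : Type := ExteriorAlgebra ℚ (Fin (2 * N) → ℚ)

/-- The orthogonal complement of `b` and `S` over the rationals. -/
abbrev orthSpace (b : Vec N) (S : Finset (Vec N)) : Submodule ℚ (Fin (2 * N) → ℚ) :=
  perp (qcast '' ↑(insert b S))

theorem mem_orthSpace {S : Finset (Vec N)} {z : Fin (2 * N) → ℚ} :
    z ∈ orthSpace b S ↔ ∀ v ∈ insert b S, symp z (qcast v) = 0 :=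
  ⟨fun h v hv => h _ ⟨v, hv, rfl⟩, by rintro h _ ⟨v, hv, rfl⟩; exact h v hv⟩

/-- The coefficient system `Λ³((S, b)^⊥)`. -/
abbrev wedgeCoeff (b : Vec N) (S : Finset (Vec N)) : Submodule ℚ (Wedge N) := wedge3 (orthSpace b S)

theorem smul_mem_tensorCoeff {E : Type*} [AddCommGroup E] [Module ℚ E]
    {M : Finset (Vec N) → Submodule ℚ E} {S : Finset (Vec N)} {z : Fin (2 * N) → ℚ} {e : E}
    (hz : z ∈ orthSpace b S) (he : e ∈ M S) : (fun i => z i • e) ∈ tensorCoeff b M S := by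
  refine mem_tensorCoeff.2 ⟨fun i => Submodule.smul_mem _ _ he, fun v hv => ?_⟩
  rw [evalAt_apply]
  simp only [smul_smul, ← Finset.sum_smul]
  have := mem_orthSpace.1 hz v hv
  rw [symp_eq_sum_single] at this
  simp only [mul_comm] at this ⊢
  rw [this, zero_smul]

/-- The multilinear map sending three vectors to their tensor product. -/
def tensorMap (N : ℕ) : MultilinearMap ℚ (fun _ : Fin 3 => Fin (2 * N) → ℚ)
    (Fin (2 * N) → Fin (2 * N) → Fin (2 * N) → ℚ) :=
  MultilinearMap.pi fun i => MultilinearMap.pi fun j => MultilinearMap.pi fun k =>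
    (MultilinearMap.mkPiAlgebra ℚ (Fin 3) ℚ).compLinearMap fun l => LinearMap.proj (![i, j, k] l)

theorem tensorMap_apply (z : Fin 3 → Fin (2 * N) → ℚ) :
    tensorMap N z = fun i => z 0 i • fun j => z 1 j • fun k => z 2 k • (1 : ℚ) := by
  ext i j k
  simp [tensorMap, Fin.prod_univ_three, mul_assoc]

theorem tensorMap_mem {S : Finset (Vec N)} {z : Fin 3 → Fin (2 * N) → ℚ}
    (hz : ∀ i, z i ∈ orthSpace b S) : tensorMap N z ∈ tensorCube b S := by
  rw [tensorMap_apply]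
  exact smul_mem_tensorCoeff (hz 0) (smul_mem_tensorCoeff (hz 1)
    (smul_mem_tensorCoeff (hz 2) trivial))

/-- Wedge products to antisymmetric tensors. -/
noncomputable def toTensor (N : ℕ) :
    Wedge N →ₗ[ℚ] (Fin (2 * N) → Fin (2 * N) → Fin (2 * N) → ℚ) :=
  ExteriorAlgebra.liftAlternating
    (Pi.single 3 (MultilinearMap.alternatization (tensorMap N)))

theorem ιMulti_three (z : Fin 3 → Fin (2 * N) → ℚ) : ExteriorAlgebra.ιMulti ℚ 3 z =
    ExteriorAlgebra.ι ℚ (z 0) * ExteriorAlgebra.ι ℚ (z 1) * ExteriorAlgebra.ι ℚ (z 2) := by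
  simp [ExteriorAlgebra.ιMulti_apply, mul_assoc]
  rfl

theorem toTensor_ιMulti (z : Fin 3 → Fin (2 * N) → ℚ) :
    toTensor N (ExteriorAlgebra.ιMulti ℚ 3 z) =
      ∑ s : Equiv.Perm (Fin 3), Equiv.Perm.sign s • tensorMap N (fun i => z (s i)) := by
  rw [toTensor, ExteriorAlgebra.liftAlternating_apply_ιMulti, Pi.single_eq_same,
    MultilinearMap.alternatization_apply]
  rfl

theorem wedge3_induction {W : Submodule ℚ (Fin (2 * N) → ℚ)} {p : Submodule ℚ (Wedge N)}
    (h : ∀ z : Fin 3 → Fin (2 * N) → ℚ, (∀ i, z i ∈ W) → ExteriorAlgebra.ιMulti ℚ 3 z ∈ p) :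
    wedge3 W ≤ p := by
  refine Submodule.span_le.2 ?_
  rintro _ ⟨z₁, h₁, z₂, h₂, z₃, h₃, rfl⟩
  have := h ![z₁, z₂, z₃] (by intro i; fin_cases i <;> assumption)
  rw [ιMulti_three] at this
  exact this

theorem toTensor_mem {S : Finset (Vec N)} {x : Wedge N} (hx : x ∈ wedgeCoeff b S) :
    toTensor N x ∈ tensorCube b S := by
  suffices h : wedgeCoeff b S ≤ (tensorCube b S).comap (toTensor N) from h hx
  refine wedge3_induction fun z hz => ?_
  rw [Submodule.mem_comap, toTensor_ιMulti]
  refine Submodule.sum_mem _ fun s _ => ?_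
  rw [Units.smul_def, ← Int.cast_smul_eq_zsmul ℚ]
  exact Submodule.smul_mem _ _ (tensorMap_mem fun i => hz _)

/-- Contraction of the first tensor factor by left multiplication. -/
noncomputable def mulFirst {E : Type*} [AddCommGroup E] [Module ℚ E] (φ : E →ₗ[ℚ] Wedge N) :
    (Fin (2 * N) → E) →ₗ[ℚ] Wedge N :=
  ∑ i, LinearMap.mulLeft ℚ (ExteriorAlgebra.ι ℚ (Pi.single i (1 : ℚ))) ∘ₗ φ ∘ₗ LinearMap.proj i

theorem mulFirst_apply {E : Type*} [AddCommGroup E] [Module ℚ E] (φ : E →ₗ[ℚ] Wedge N)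
    (h : Fin (2 * N) → E) :
    mulFirst φ h = ∑ i, ExteriorAlgebra.ι ℚ (Pi.single i (1 : ℚ)) * φ (h i) := by
  simp [mulFirst]

theorem mulFirst_smul {E : Type*} [AddCommGroup E] [Module ℚ E] (φ : E →ₗ[ℚ] Wedge N)
    (z : Fin (2 * N) → ℚ) (e : E) :
    mulFirst φ (fun i => z i • e) = ExteriorAlgebra.ι ℚ z * φ e := by
  rw [mulFirst_apply]
  conv_rhs => rw [← LinearMap.sum_single_apply (fun _ => ℚ) z, map_sum, Finset.sum_mul]
  refine Finset.sum_congr rfl fun i _ => ?_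
  have : Pi.single i (z i) = z i • (Pi.single i 1 : Fin (2 * N) → ℚ) := by
    rw [← Pi.single_smul, smul_eq_mul, mul_one]
  simp only [this, map_smul, smul_mul_assoc, mul_smul_comm]

theorem mulFirst_mem {E : Type*} [AddCommGroup E] [Module ℚ E]
    {M : Finset (Vec N) → Submodule ℚ E} {S : Finset (Vec N)} (hS : Good b S)
    (hb : ∃ o, symp o b = 1) {φ : E →ₗ[ℚ] Wedge N} {B : Submodule ℚ (Wedge N)}
    (hφ : ∀ e ∈ M S, φ e ∈ B) {h : Fin (2 * N) → E} (hh : h ∈ tensorCoeff b M S) :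
    mulFirst φ h ∈ (orthSpace b S).map (ExteriorAlgebra.ι ℚ) * B := by
  obtain ⟨l, hl⟩ := hS.exists_dual_family hb
  rw [mem_tensorCoeff] at hh
  have key : mulFirst φ h = ∑ i, ExteriorAlgebra.ι ℚ (Pi.single i (1 : ℚ) -
      ∑ u ∈ insert b S, symp (Pi.single i 1) (qcast u) • qcast (l u)) * φ (h i) := by
    rw [mulFirst_apply, eq_comm, ← sub_eq_zero, ← Finset.sum_sub_distrib]
    have h1 : ∀ u ∈ insert b S, ∑ i, symp (Pi.single i 1) (qcast u) • φ (h i) = 0 := by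
      intro u hu
      have := hh.2 u hu
      rw [evalAt_apply] at this
      rw [← map_zero φ, ← this, map_sum]
      simp only [map_smul]
    have h2 : ∑ u ∈ insert b S, ExteriorAlgebra.ι ℚ (qcast (l u)) *
        ∑ i, symp (Pi.single i 1) (qcast u) • φ (h i) = 0 :=
      Finset.sum_eq_zero fun u hu => by rw [h1 u hu, mul_zero]
    rw [← neg_eq_zero, ← h2, ← Finset.sum_neg_distrib]
    simp only [Finset.mul_sum]
    rw [Finset.sum_comm]
    refine Finset.sum_congr rfl fun i _ => ?_
    rw [map_sub, sub_mul, sub_sub_cancel_left, neg_neg, map_sum, Finset.sum_mul]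
    refine Finset.sum_congr rfl fun u _ => ?_
    rw [map_smul, smul_mul_assoc, mul_smul_comm]
  rw [key]
  refine Submodule.sum_mem _ fun i _ => Submodule.mul_mem_mul
    (Submodule.mem_map_of_mem (mem_orthSpace.2 fun v hv => ?_)) (hφ _ (hh.1 i))
  rw [symp_sub_left, symp_sum_left, Finset.sum_eq_single v]
  · rw [symp_smul_left, symp_qcast, hl v hv v hv, if_pos rfl]; simp
  · intro u hu hne
    rw [symp_smul_left, symp_qcast, hl u hu v hv, if_neg hne]; simp
  · exact fun h => absurd hv h

/-- Tensors to wedge products. -/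
noncomputable def ofTensor (N : ℕ) :
    (Fin (2 * N) → Fin (2 * N) → Fin (2 * N) → ℚ) →ₗ[ℚ] Wedge N :=
  mulFirst (mulFirst (mulFirst (Algebra.linearMap ℚ _)))

theorem ofTensor_tensorMap (z : Fin 3 → Fin (2 * N) → ℚ) :
    ofTensor N (tensorMap N z) = ExteriorAlgebra.ιMulti ℚ 3 z := by
  rw [tensorMap_apply, ofTensor, mulFirst_smul, mulFirst_smul, mulFirst_smul, ιMulti_three]
  simp [mul_assoc]

theorem ofTensor_toTensor {S : Finset (Vec N)} {x : Wedge N} (hx : x ∈ wedgeCoeff b S) :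
    ofTensor N (toTensor N x) = (6 : ℚ) • x := by
  suffices h : wedgeCoeff b S ≤
      LinearMap.eqLocus (ofTensor N ∘ₗ toTensor N) ((6 : ℚ) • LinearMap.id) from h hx
  refine wedge3_induction fun z _ => ?_
  rw [LinearMap.mem_eqLocus, LinearMap.comp_apply, toTensor_ιMulti, map_sum]
  have h1 : ∀ s : Equiv.Perm (Fin 3),
      ofTensor N (Equiv.Perm.sign s • tensorMap N fun i => z (s i)) =
        ExteriorAlgebra.ιMulti ℚ 3 z := by
    intro s
    have h2 := (ExteriorAlgebra.ιMulti ℚ 3 (M := Fin (2 * N) → ℚ)).map_perm z s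
    rw [Units.smul_def, map_zsmul, ofTensor_tensorMap, ← Units.smul_def]
    change Equiv.Perm.sign s • ExteriorAlgebra.ιMulti ℚ 3 (z ∘ s) = _
    rw [h2, smul_smul, Int.units_mul_self, one_smul]
  rw [Finset.sum_congr rfl fun s _ => h1 s, Finset.sum_const, Finset.card_univ, Fintype.card_perm,
    Fintype.card_fin, ← Nat.cast_smul_eq_nsmul ℚ]
  norm_num [Nat.factorial]

theorem ofTensor_mem {S : Finset (Vec N)} (hS : Good b S) (hb : ∃ o, symp o b = 1)
    {h : Fin (2 * N) → Fin (2 * N) → Fin (2 * N) → ℚ} (hh : h ∈ tensorCube b S) :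
    ofTensor N h ∈ wedgeCoeff b S := by
  have h1 := mulFirst_mem hS hb (fun e he => mulFirst_mem hS hb (fun e he => mulFirst_mem hS hb
    (φ := Algebra.linearMap ℚ (Wedge N)) (B := 1) (fun e _ => Submodule.algebraMap_mem e) he) he) hh
  rw [mul_one] at h1
  refine Submodule.mul_le.2 ?_ h1
  rintro _ ⟨z₁, h₁, rfl⟩ y hy
  refine Submodule.mul_induction_on hy ?_ fun y y' hy hy' => by
    rw [mul_add]; exact Submodule.add_mem _ hy hy'
  rintro _ ⟨z₂, h₂, rfl⟩ _ ⟨z₃, h₃, rfl⟩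
  exact Submodule.subset_span ⟨z₁, h₁, z₂, h₂, z₃, h₃, by rw [mul_assoc]⟩

theorem exactAt_wedgeCoeff (hN : 7 ≤ N) (hb : ∃ o, symp o b = 1) :
    ExactAt b (wedgeCoeff b) ∅ := by
  intro K ξ hξ hcyc
  obtain ⟨K', η, hη, hsum⟩ := exactAt_tensorCube hN hb K (fun x y => toTensor N (ξ x y))
    ⟨fun x y => by rw [hξ.swap, map_neg], fun x y h => by rw [hξ.supp x y h, map_zero],
      fun x y => toTensor_mem (hξ.mem x y), fun x y h => by rw [hξ.fin x y h, map_zero]⟩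
    (fun y => by rw [← map_sum, hcyc, map_zero])
  refine ⟨K', fun x y z => (6 : ℚ)⁻¹ • ofTensor N (η x y z), ⟨?_, ?_, ?_, ?_, ?_⟩, ?_⟩
  · intro x y z; rw [hη.swap_left, map_neg, smul_neg]
  · intro x y z; rw [hη.swap_right, map_neg, smul_neg]
  · intro x y z h; rw [hη.supp x y z h, map_zero, smul_zero]
  · intro x y z
    by_cases h : IsTri b ∅ x y z
    · exact Submodule.smul_mem _ _ (ofTensor_mem h.good hb (hη.mem x y z))
    · rw [hη.supp x y z h, map_zero, smul_zero]; exact Submodule.zero_mem _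
  · intro x y z h; rw [hη.fin x y z h, map_zero, smul_zero]
  · intro x y
    rw [← Finset.smul_sum, ← map_sum, hsum, ofTensor_toTensor (hξ.mem x y), smul_smul]
    norm_num

end WedgeCoefficients

section Splitting

variable {N : ℕ} {b : Vec N}

/-- A subspace of vectors each pairing nontrivially with at most one of four vectors
decomposes its third exterior power. -/
theorem wedge3_le_of_dual {W : Submodule ℚ (Fin (2 * N) → ℚ)} {h e : Fin 4 → Fin (2 * N) → ℚ}
    (he : ∀ i, e i ∈ W) (hd : ∀ i j, symp (e i) (h j) = if i = j then 1 else 0)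
    {p : Submodule ℚ (Wedge N)}
    (hp : ∀ k, ∀ z : Fin 3 → Fin (2 * N) → ℚ, (∀ i, z i ∈ W ∧ symp (z i) (h k) = 0) →
      ExteriorAlgebra.ιMulti ℚ 3 z ∈ p) : wedge3 W ≤ p := by
  let G : Set (Fin (2 * N) → ℚ) := {x | x ∈ W ∧ ∃ k, ∀ j, j ≠ k → symp x (h j) = 0}
  have hG : W ≤ Submodule.span ℚ G := by
    intro z hz
    have hr : ∀ j, symp (z - ∑ i, symp z (h i) • e i) (h j) = 0 := by
      intro j
      rw [symp_sub_left, symp_sum_left]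
      simp [symp_smul_left, hd]
    rw [← sub_add_cancel z (∑ i, symp z (h i) • e i)]
    refine Submodule.add_mem _ (Submodule.subset_span ⟨Submodule.sub_mem _ hz
      (Submodule.sum_mem _ fun i _ => Submodule.smul_mem _ _ (he i)), 0, fun j _ => hr j⟩)
      (Submodule.sum_mem _ fun i _ => Submodule.smul_mem _ _ (Submodule.subset_span
        ⟨he i, i, fun j hj => by rw [hd, if_neg hj.symm]⟩))
  refine (Submodule.span_le.2 ?_ : wedge3 W ≤ Submodule.span ℚ (ExteriorAlgebra.ι ℚ '' G) *
    Submodule.span ℚ (ExteriorAlgebra.ι ℚ '' G) *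
      Submodule.span ℚ (ExteriorAlgebra.ι ℚ '' G)).trans ?_
  · have hι : ∀ z ∈ W, ExteriorAlgebra.ι ℚ z ∈ Submodule.span ℚ (ExteriorAlgebra.ι ℚ '' G) := by
      intro z hz
      rw [← Submodule.map_span]
      exact Submodule.mem_map_of_mem (hG hz)
    rintro _ ⟨z₁, h₁, z₂, h₂, z₃, h₃, rfl⟩
    exact Submodule.mul_mem_mul (Submodule.mul_mem_mul (hι _ h₁) (hι _ h₂)) (hι _ h₃)
  · rw [Submodule.span_mul_span, Submodule.span_mul_span, Submodule.span_le]
    rintro _ ⟨_, ⟨_, ⟨z₁, ⟨h₁, k₁, o₁⟩, rfl⟩, _, ⟨z₂, ⟨h₂, k₂, o₂⟩, rfl⟩, rfl⟩, _,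
      ⟨z₃, ⟨h₃, k₃, o₃⟩, rfl⟩, rfl⟩
    obtain ⟨k, e₁, e₂, e₃⟩ : ∃ k : Fin 4, k ≠ k₁ ∧ k ≠ k₂ ∧ k ≠ k₃ :=
      (by decide : ∀ k₁ k₂ k₃ : Fin 4, ∃ k : Fin 4, k ≠ k₁ ∧ k ≠ k₂ ∧ k ≠ k₃) k₁ k₂ k₃
    have := hp k ![z₁, z₂, z₃] (by
      intro i
      fin_cases i
      · exact ⟨h₁, o₁ k e₁⟩
      · exact ⟨h₂, o₂ k e₂⟩
      · exact ⟨h₃, o₃ k e₃⟩)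
    rw [ιMulti_three] at this
    exact this

/-- Four vectors with dual vectors, all orthogonal to `b` and to an edge. -/
theorem exists_four_dual (hN : 7 ≤ N) {a c : Vec N} (ha : symp a b = 1) :
    ∃ h e : Fin 4 → Vec N, (∀ i j, symp (e i) (h j) = if i = j then 1 else 0) ∧
      ∀ i, ∀ v ∈ ({b, a, c} : Finset (Vec N)), symp (h i) v = 0 ∧ symp (e i) v = 0 := by
  obtain ⟨h, k, hk, kh, H⟩ := exists_hyperbolic_orth hN ha {c} (by simp)
  obtain ⟨h', k', hk', kh', H'⟩ := exists_hyperbolic_orth hN ha {c, h, k}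
    (Finset.card_le_three.trans (by norm_num))
  simp only [Finset.mem_insert, Finset.mem_singleton, forall_eq_or_imp, forall_eq] at H H'
  refine ⟨![h, k, h', k'], ![-k, h, -k', h'], ?_, ?_⟩
  · intro i j
    fin_cases i <;> fin_cases j <;> simp [symp_neg_left, symp_self, *]
  · intro i v hv
    simp only [Finset.mem_insert, Finset.mem_singleton] at hv
    rcases hv with rfl | rfl | rfl <;> fin_cases i <;> simp [symp_neg_left, *]

end Splitting

section Chains

variable {N : ℕ} {b : Vec N}

/-- `diff` as a linear map. -/
noncomputable def diffLin (N p : ℕ) : ((Fin (p + 1) → Vec N) →₀ Wedge N) →ₗ[ℚ]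
    ((Fin p → Vec N) →₀ Wedge N) :=
  Finsupp.lsum ℚ fun w =>
    ∑ j : Fin (p + 1), ((-1 : ℚ) ^ (j : ℕ)) • Finsupp.lsingle fun i => w (j.succAbove i)

theorem diffLin_apply (N p : ℕ) (η : (Fin (p + 1) → Vec N) →₀ Wedge N) :
    diffLin N p η = diff N p η := by
  rw [diffLin, Finsupp.lsum_apply, diff]
  refine Finsupp.sum_congr fun w _ => ?_
  rw [LinearMap.sum_apply]
  rfl

theorem diff_apply {p : ℕ} {η : (Fin (p + 1) → Vec N) →₀ Wedge N} {K : Finset (Vec N)}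
    (hK : ∀ v, η v ≠ 0 → ∀ i, v i ∈ K) (w : Fin p → Vec N) :
    diff N p η w = ∑ j : Fin (p + 1), (-1 : ℚ) ^ (j : ℕ) • ∑ z ∈ K, η (j.insertNth z w) := by
  classical
  rw [diff, Finsupp.sum, Finsupp.finsetSum_apply]
  simp only [Finsupp.finsetSum_apply, Finsupp.smul_apply, Finsupp.single_apply]
  rw [Finset.sum_comm]
  refine Finset.sum_congr rfl fun j _ => ?_
  rw [← Finset.smul_sum]
  congr 1
  have h1 : ∀ z ∈ K, η (j.insertNth z w) =
      ∑ v ∈ η.support, if j.insertNth z w = v then η v else 0 := by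
    intro z _
    rw [Finset.sum_ite_eq]
    simp [eq_comm]
  rw [Finset.sum_congr rfl h1, Finset.sum_comm]
  refine Finset.sum_congr rfl fun v hv => ?_
  have hvK := hK v (Finsupp.mem_support_iff.1 hv) j
  by_cases h : (fun i => v (j.succAbove i)) = w
  · rw [if_pos h, Finset.sum_eq_single (v j)]
    · rw [if_pos]
      rw [← h]
      exact Fin.insertNth_self_removeNth j v
    · intro z _ hz
      rw [if_neg]
      rintro rfl
      simp at hz
    · exact fun h => absurd hvK h
  · rw [if_neg h, Finset.sum_eq_zero]
    intro z _
    rw [if_neg]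
    rintro rfl
    exact h (funext fun i => by simp)

/-- The `2`-chains of the complex. -/
def chains (b : Vec N) : Submodule ℚ ((Fin 3 → Vec N) →₀ Wedge N) where
  carrier := {η | (∀ w, ¬IsTri b ∅ (w 0) (w 1) (w 2) → η w = 0) ∧
    ∀ w, η w ∈ wedgeCoeff b (insert (w 0) (insert (w 1) (insert (w 2) ∅)))}
  zero_mem' := ⟨fun _ _ => rfl, fun _ => Submodule.zero_mem _⟩
  add_mem' := by
    rintro x y ⟨h1, h2⟩ ⟨h3, h4⟩
    exact ⟨fun w hw => by rw [Finsupp.add_apply, h1 w hw, h3 w hw, add_zero],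
      fun w => Submodule.add_mem _ (h2 w) (h4 w)⟩
  smul_mem' := by
    rintro c x ⟨h1, h2⟩
    exact ⟨fun w hw => by rw [Finsupp.smul_apply, h1 w hw, smul_zero],
      fun w => Submodule.smul_mem _ _ (h2 w)⟩

/-- The boundaries of `2`-chains. -/
noncomputable abbrev bounds (b : Vec N) : Submodule ℚ ((Fin 2 → Vec N) →₀ Wedge N) :=
  (chains b).map (diffLin N 2)

theorem single_mem_chains {x y z : Vec N} (h : IsTri b ∅ x y z) {m : Wedge N}
    (hm : m ∈ wedgeCoeff b (insert x (insert y (insert z ∅)))) :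
    Finsupp.single ![x, y, z] m ∈ chains b := by
  classical
  constructor
  · intro w hw
    rw [Finsupp.single_apply, if_neg]
    rintro rfl
    exact hw h
  · intro w
    rw [Finsupp.single_apply]
    split_ifs with hw
    · subst hw; exact hm
    · exact Submodule.zero_mem _

theorem diffLin_single (x y z : Vec N) (m : Wedge N) :
    diffLin N 2 (Finsupp.single ![x, y, z] m) =
      Finsupp.single ![y, z] m - Finsupp.single ![x, z] m + Finsupp.single ![x, y] m := by
  have h1 : (fun i => ![x, y, z] ((1 : Fin 3).succAbove i)) = ![x, z] := by
    funext i; fin_cases i <;> rfl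
  have h2 : (fun i => ![x, y, z] ((2 : Fin 3).succAbove i)) = ![x, y] := by
    funext i; fin_cases i <;> rfl
  simp [diffLin, Fin.sum_univ_three, h1, h2, sub_eq_add_neg]

/-- Symmetric `1`-chains are boundaries. -/
theorem single_add_single_mem_bounds (hN : 7 ≤ N) {a c : Vec N} (h : IsEdge b ∅ a c) {m : Wedge N}
    (hm : m ∈ wedgeCoeff b (insert a (insert c ∅))) :
    Finsupp.single ![a, c] m + Finsupp.single ![c, a] m ∈ bounds b := by
  let φ : Wedge N →ₗ[ℚ] ((Fin 2 → Vec N) →₀ Wedge N) :=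
    Finsupp.lsingle ![a, c] + Finsupp.lsingle ![c, a]
  suffices hle : wedgeCoeff b (insert a (insert c ∅)) ≤ (bounds b).comap φ from hle hm
  obtain ⟨x, e, hd, ho⟩ := exists_four_dual hN (c := c) h.1.height
  simp only [Finset.mem_insert, Finset.mem_singleton, forall_eq_or_imp, forall_eq] at ho
  refine wedge3_le_of_dual (h := fun i => qcast (x i)) (e := fun i => qcast (e i)) ?_ ?_ ?_
  · intro i
    refine mem_orthSpace.2 ?_
    simp [symp_qcast, ho]
  · intro i j
    rw [symp_qcast, hd]
    split_ifs <;> simp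
  · intro k z hz
    have hac := h.orth
    have hca : symp c a = 0 := h.symm.orth
    have hT : IsTri b ∅ a c (a + x k) := by
      refine ⟨h.1, h.2, ext_of_dual (d := e k) h.2.2 ?_ ?_ ?_ ?_⟩
      · simp [symp_add_left, h.1.height, ho]
      · simp [symp_add_left, ho, hac, symp_self]
      · simp [symp_add_right, ho, hd]
      · simp [ho]
    have hmem : ExteriorAlgebra.ιMulti ℚ 3 z ∈
        wedgeCoeff b (insert a (insert c (insert (a + x k) ∅))) := by
      rw [ιMulti_three]
      have hz' : ∀ i, z i ∈ orthSpace b (insert a (insert c (insert (a + x k) ∅))) := by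
        intro i
        have h1 := mem_orthSpace.1 (hz i).1
        refine mem_orthSpace.2 ?_
        have h2 : qcast (a + x k) = qcast a + qcast (x k) := by
          funext j; simp [qcast]
        simp only [Finset.mem_insert, Finset.notMem_empty, or_false, forall_eq_or_imp,
          forall_eq] at h1 ⊢
        refine ⟨h1.1, h1.2.1, h1.2.2, ?_⟩
        rw [h2, symp_add_right, h1.2.1, (hz i).2, add_zero]
      exact Submodule.subset_span ⟨_, hz' 0, _, hz' 1, _, hz' 2, rfl⟩
    have hmem' := hmem
    rw [Finset.insert_comm] at hmem'
    refine ⟨_, Submodule.add_mem _ (single_mem_chains hT hmem)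
      (single_mem_chains hT.swap_left hmem'), ?_⟩
    rw [map_add, diffLin_single, diffLin_single]
    simp only [φ, LinearMap.add_apply, Finsupp.lsingle_apply]
    abel

/-- Cycles of the complex are boundaries. -/
theorem cycle_mem_bounds (hN : 7 ≤ N) (hb : ∃ o, symp o b = 1)
    {ξ : (Fin 2 → Vec N) →₀ Wedge N} (hsupp : ∀ w, ¬IsEdge b ∅ (w 0) (w 1) → ξ w = 0)
    (hval : ∀ w, ξ w ∈ wedgeCoeff b (insert (w 0) (insert (w 1) ∅)))
    (hclosed : diff N 1 ξ = 0) : ξ ∈ bounds b := by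
  classical
  let swap : (Fin 2 → Vec N) → (Fin 2 → Vec N) := fun w => ![w 1, w 0]
  have hw : ∀ w : Fin 2 → Vec N, ![w 0, w 1] = w := fun w => by
    funext i; fin_cases i <;> rfl
  have hswap : Function.Injective swap := by
    intro w w' h
    have h0 := congrFun h 0
    have h1 := congrFun h 1
    rw [← hw w, ← hw w']
    simp only [swap, Matrix.cons_val_zero, Matrix.cons_val_one] at h0 h1
    rw [h0, h1]
  have hsym : ξ + ξ.mapDomain swap ∈ bounds b := by
    have h1 : ξ + ξ.mapDomain swap =
        ∑ w ∈ ξ.support, (Finsupp.single w (ξ w) + Finsupp.single (swap w) (ξ w)) := by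
      rw [Finset.sum_add_distrib]
      conv_lhs => rw [← Finsupp.sum_single ξ]
      rw [Finsupp.sum_single]
      congr 1
      exact (Finsupp.sum_single ξ).symm
    rw [h1]
    refine Submodule.sum_mem _ fun w hwξ => ?_
    have he : IsEdge b ∅ (w 0) (w 1) := by
      by_contra h
      exact Finsupp.mem_support_iff.1 hwξ (hsupp w h)
    have := single_add_single_mem_bounds hN he (hval w)
    rwa [hw] at this
  have hmap : ∀ x y, ξ.mapDomain swap ![x, y] = ξ ![y, x] := fun x y =>
    Finsupp.mapDomain_apply hswap ξ ![y, x]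
  let K : Finset (Vec N) := ξ.support.biUnion fun w => {w 0, w 1}
  have hK : ∀ w, ξ w ≠ 0 → ∀ i, w i ∈ K := by
    intro w hne i
    refine Finset.mem_biUnion.2 ⟨w, Finsupp.mem_support_iff.2 hne, ?_⟩
    fin_cases i <;> simp
  have hK0 : ∀ x y, x ∉ K → ξ ![x, y] = 0 := fun x y hx => by
    by_contra h; exact hx (hK _ h 0)
  have hK1 : ∀ x y, y ∉ K → ξ ![x, y] = 0 := fun x y hy => by
    by_contra h; exact hy (hK _ h 1)
  have hcyc : ∀ y, ∑ x ∈ K, ξ ![x, y] = ∑ x ∈ K, ξ ![y, x] := by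
    intro y
    have h1 := diff_apply hK ![y]
    have h2 : ∀ z : Vec N, (0 : Fin 2).insertNth (α := fun _ => Vec N) z ![y] = ![z, y] := fun z => by
      funext i; fin_cases i <;> rfl
    have h3 : ∀ z : Vec N, (1 : Fin 2).insertNth (α := fun _ => Vec N) z ![y] = ![y, z] := fun z => by
      funext i; fin_cases i <;> rfl
    rw [hclosed, Fin.sum_univ_two] at h1
    simp only [h2, h3] at h1
    rw [← sub_eq_zero]
    simpa [sub_eq_add_neg] using h1.symm
  obtain ⟨K', η, hη, hsum⟩ := exactAt_wedgeCoeff hN hb K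
    (fun x y => (2 : ℚ)⁻¹ • (ξ ![x, y] - ξ ![y, x]))
    ⟨fun x y => by rw [← smul_neg, neg_sub],
      fun x y h => by
        rw [hsupp ![x, y] h, hsupp ![y, x] fun h' => h h'.symm, sub_zero, smul_zero],
      fun x y => by
        refine Submodule.smul_mem _ _ (Submodule.sub_mem _ (hval ![x, y]) ?_)
        rw [Finset.insert_comm]
        exact hval ![y, x],
      fun x y h => by rw [hK0 x y h, hK1 y x h, sub_zero, smul_zero]⟩
    (fun y => by rw [← Finset.smul_sum, Finset.sum_sub_distrib, hcyc, sub_self, smul_zero])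
  have hηK : ∀ w : Fin 3 → Vec N, η (w 0) (w 1) (w 2) ≠ 0 → ∀ i, w i ∈ K' := by
    intro w hne i
    by_contra h
    refine hne ?_
    fin_cases i
    · exact hη.fin _ _ _ h
    · rw [hη.swap_left, hη.fin (w 1) _ _ h, neg_zero]
    · rw [hη.swap_right, hη.swap_left, hη.fin (w 2) _ _ h, neg_zero, neg_zero]
  let θ : (Fin 3 → Vec N) →₀ Wedge N := Finsupp.onFinset (Fintype.piFinset fun _ => K')
    (fun w => (3 : ℚ)⁻¹ • η (w 0) (w 1) (w 2)) fun w hne =>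
      Fintype.mem_piFinset.2 (hηK w fun h => hne (by rw [h, smul_zero]))
  have hθ : θ ∈ chains b := by
    refine ⟨fun w h => ?_, fun w => Submodule.smul_mem _ _ (hη.mem _ _ _)⟩
    change (3 : ℚ)⁻¹ • η (w 0) (w 1) (w 2) = 0
    rw [hη.supp _ _ _ h, smul_zero]
  have hdiff : diffLin N 2 θ = (2 : ℚ)⁻¹ • (ξ - ξ.mapDomain swap) := by
    ext1 w
    rw [diffLin_apply, diff_apply (K := K') (fun v hne => hηK v fun h => hne (by
      change (3 : ℚ)⁻¹ • η (v 0) (v 1) (v 2) = 0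
      rw [h, smul_zero])), Fin.sum_univ_three, Finsupp.smul_apply, Finsupp.sub_apply,
      ← hw w, hmap, ← hsum]
    have h0 : ∀ z, θ ((0 : Fin 3).insertNth z ![w 0, w 1]) = (3 : ℚ)⁻¹ • η z (w 0) (w 1) :=
      fun _ => rfl
    have h1 : ∀ z, θ ((1 : Fin 3).insertNth z ![w 0, w 1]) = -((3 : ℚ)⁻¹ • η z (w 0) (w 1)) :=
      fun z => by
        rw [← smul_neg, ← hη.swap_left]; rfl
    have h2 : ∀ z, θ ((2 : Fin 3).insertNth z ![w 0, w 1]) = (3 : ℚ)⁻¹ • η z (w 0) (w 1) :=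
      fun z => by
        rw [hη.swap_left, hη.swap_right, neg_neg]; rfl
    simp only [h0, h1, h2, Finset.sum_neg_distrib, ← Finset.smul_sum, Fin.val_zero, Fin.val_one,
      Fin.val_two]
    module
  have key : ξ = (2 : ℚ)⁻¹ • (ξ + ξ.mapDomain swap) + diffLin N 2 θ := by
    rw [hdiff]; module
  rw [key]
  exact Submodule.add_mem _ (Submodule.smul_mem _ _ hsym) (Submodule.mem_map_of_mem hθ)

end Chains

section Comparison

variable {N : ℕ}

theorem qcast_stdB (N i : ℕ) : qcast (stdB ℤ N i) = stdB ℚ N i := by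
  funext j
  simp [qcast, stdB]

theorem perp_eq_orthSpace {m : ℕ} {w : Fin m → Vec N} {S : Finset (Vec N)}
    (hS : Set.range w = S) :
    perp (insert (stdB ℚ N 0) (Set.range fun i => qcast (w i))) = orthSpace (stdB ℤ N 0) S := by
  rw [orthSpace, Finset.coe_insert, Set.image_insert_eq, qcast_stdB, ← hS, ← Set.range_comp]
  rfl

end Comparison

set_option synthInstance.maxHeartbeats 1000000 in
/-- exactness of `C_3 → C_2 → C_1` at `C_2` for the complex `Λ̂(g)`. -/
theorem stmt1 (g : ℕ) (hg : 6 ≤ g)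
    (ξ : (Fin 2 → Fin (2 * (g + 1)) → ℤ) →₀ ExteriorAlgebra ℚ (Fin (2 * (g + 1)) → ℚ))
    (hsupp : ∀ w : Fin 2 → Fin (2 * (g + 1)) → ℤ,
      ¬(PairwiseOrth w ∧ (∀ i, w i ⟨0, by omega⟩ = 1) ∧ IsUnimodular w) → ξ w = 0)
    (hval : ∀ w : Fin 2 → Fin (2 * (g + 1)) → ℤ, ξ w ∈
      wedge3 (perp (insert (stdB ℚ (g + 1) 0) (Set.range fun i => qcast (w i)))))
    (hclosed : diff (g + 1) 1 ξ = 0) :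
    ∃ η : (Fin 3 → Fin (2 * (g + 1)) → ℤ) →₀ ExteriorAlgebra ℚ (Fin (2 * (g + 1)) → ℚ),
      (∀ w : Fin 3 → Fin (2 * (g + 1)) → ℤ,
        ¬(PairwiseOrth w ∧ (∀ i, w i ⟨0, by omega⟩ = 1) ∧ IsUnimodular w) → η w = 0) ∧
      (∀ w : Fin 3 → Fin (2 * (g + 1)) → ℤ, η w ∈
        wedge3 (perp (insert (stdB ℚ (g + 1) 0) (Set.range fun i => qcast (w i))))) ∧
      diff (g + 1) 2 η = ξ := by
  have hN : 7 ≤ g + 1 := by omega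
  have hb : ∃ o, symp o (stdB ℤ (g + 1) 0) = 1 :=
    ⟨stdA ℤ (g + 1) 0, by rw [symp_stdB (by omega)]; rfl⟩
  have hrange₂ : ∀ w : Fin 2 → Vec (g + 1),
      Set.range w = (insert (w 0) (insert (w 1) ∅) : Finset (Vec (g + 1))) := fun w => by
    ext v; simp [Fin.exists_fin_two, eq_comm]
  have hrange₃ : ∀ w : Fin 3 → Vec (g + 1),
      Set.range w = (insert (w 0) (insert (w 1) (insert (w 2) ∅)) : Finset (Vec (g + 1))) :=
    fun w => by ext v; simp [Fin.exists_fin_succ, eq_comm]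
  simp only [← symp_stdB (Nat.succ_pos g)] at hsupp ⊢
  obtain ⟨η, ⟨hη, hmem⟩, rfl⟩ := cycle_mem_bounds hN hb
    (fun w hw => hsupp w (mt isSimplex_two_iff.1 hw))
    (fun w => by rw [wedgeCoeff, ← perp_eq_orthSpace (hrange₂ w)]; exact hval w) hclosed
  refine ⟨η, fun w hw => hη w (mt isSimplex_three_iff.2 hw), fun w => ?_,
    (diffLin_apply _ _ _).symm⟩
  rw [perp_eq_orthSpace (hrange₃ w)]
  exact hmem w

end Paper
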